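/- (Count of differentials of the second type.) For integers $a\ge0$, $b,c\ge1$, $n\ge0$, $d_1,\ldots,d_n\ge2$ with $a-b-c-\sum d_i=-2$, the number of meromorphic differentials on $\mathbb{CP}^1$ (up to the $\mathrm{PGL}(2,\mathbb C)$ action on configurations) with divisor $a[z_1]-b[z_2]-c[z_3]-\sum_i d_i[z_{3+i}]$ and vanishing residues at $z_4,\ldots,z_{3+n}$ equals $n!\prod_{i=1}^n(d_i-1)$. -/

import Mathlib

open Finset

noncomputable section

/-- The residue at `z = t` of the differential `g(z) dz` for a rational function `g`:
the coefficient of `(z - t)⁻¹` in the Laurent expansion of `g` at `t`. -/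
def residueAt (t : ℂ) (g : RatFunc ℂ) : ℂ :=
  ((RatFunc.laurent t g : RatFunc ℂ) : LaurentSeries ℂ).coeff (-1)

/-- The orders of zeros/poles for differentials of the second type:
`a` at `z₁`, `-b` at `z₂`, `-c` at `z₃`, `-dᵢ` at `z_{3+i}`. -/
def mult (a b c : ℕ) {n : ℕ} (d : Fin n → ℕ) : Fin (3 + n) → ℤ :=
  Fin.append ![(a : ℤ), -(b : ℤ), -(c : ℤ)] (fun i => -(d i : ℤ))

/-- The meromorphic differential `ω_Z = ∏ᵢ (z - zᵢ)^(mᵢ) dz` on `ℂP¹` associated to a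
configuration `Z` of marked points, as a rational function (for finite marked points). -/
def omegaZ {N : ℕ} (m : Fin N → ℤ) (Z : Fin N → ℂ) : RatFunc ℂ :=
  ∏ i, (RatFunc.X - RatFunc.C (Z i)) ^ (m i)

/-- Configurations of pairwise distinct (finite) marked points on `ℂP¹` such that the
associated differential `ω_Z` has vanishing residue at `z₄, …, z_{3+n}`.  (Every
`PGL(2,ℂ)`-orbit of configurations contains one with all points finite.) -/
def H₀second (a b c : ℕ) {n : ℕ} (d : Fin n → ℕ) : Type :=
  { Z : Fin (3 + n) → ℂ // Function.Injective Z ∧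
      ∀ j : Fin n, residueAt (Z (Fin.natAdd 3 j)) (omegaZ (mult a b c d) Z) = 0 }

/-- Two configurations are identified when they differ by the action of `PGL(2,ℂ)`,
i.e. by a Möbius transformation `z ↦ (pz+q)/(rz+s)`, `ps - qr ≠ 0`, regular at all
marked points. -/
def moebiusRel (a b c : ℕ) {n : ℕ} (d : Fin n → ℕ)
    (Z W : H₀second a b c d) : Prop :=
  ∃ p q r s : ℂ, p * s - q * r ≠ 0 ∧
    ∀ i, r * Z.val i + s ≠ 0 ∧ W.val i = (p * Z.val i + q) / (r * Z.val i + s)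

end

namespace SecondKind

open Filter Topology

set_option linter.unusedSectionVars false

/-- The Taylor coefficients of the solution `h` of `h' = L h`, `h(0) = 1`. -/
noncomputable def expCoeff (L : ℕ → ℂ) : ℕ → ℂ
  | 0 => 1
  | k + 1 => (∑ i : Fin (k + 1), expCoeff L i * L (k - i)) / (k + 1)

@[simp] lemma expCoeff_zero (L : ℕ → ℂ) : expCoeff L 0 = 1 := by rw [expCoeff]

lemma expCoeff_succ (L : ℕ → ℂ) (k : ℕ) :
    expCoeff L (k + 1) = (∑ i ∈ range (k + 1), expCoeff L i * L (k - i)) / (k + 1) := by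
  rw [expCoeff, Finset.sum_range]

/-- The power series `h` with `h' = L h` and `h(0) = 1`. -/
noncomputable def expSeries (L : ℕ → ℂ) : PowerSeries ℂ := PowerSeries.mk (expCoeff L)

@[simp] lemma coeff_expSeries (L : ℕ → ℂ) (k : ℕ) :
    PowerSeries.coeff k (expSeries L) = expCoeff L k := by simp [expSeries]

@[simp] lemma constantCoeff_expSeries (L : ℕ → ℂ) :
    PowerSeries.constantCoeff (expSeries L) = 1 := by
  rw [← PowerSeries.coeff_zero_eq_constantCoeff_apply]; simp

lemma derivative_expSeries (L : ℕ → ℂ) :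
    PowerSeries.derivative ℂ (expSeries L) = expSeries L * PowerSeries.mk L := by
  ext k
  have hk : (k : ℂ) + 1 ≠ 0 := Nat.cast_add_one_ne_zero k
  rw [PowerSeries.coeff_derivative, PowerSeries.coeff_mul,
    Finset.Nat.sum_antidiagonal_eq_sum_range_succ_mk, coeff_expSeries, expCoeff_succ,
    div_mul_cancel₀ _ hk]
  simp

/-- Uniqueness for the equation `y' = y L`. -/
lemma eq_C_mul_expSeries {L : ℕ → ℂ} {y : PowerSeries ℂ}
    (hy : PowerSeries.derivative ℂ y = y * PowerSeries.mk L) :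
    y = PowerSeries.C (PowerSeries.constantCoeff y) * expSeries L := by
  ext k
  rw [PowerSeries.coeff_C_mul, coeff_expSeries]
  induction k using Nat.strong_induction_on with
  | _ k ih =>
    rcases k with _ | k
    · simp
    · have hk : (k : ℂ) + 1 ≠ 0 := Nat.cast_add_one_ne_zero k
      have h := congrArg (PowerSeries.coeff k) hy
      rw [PowerSeries.coeff_derivative, PowerSeries.coeff_mul,
        Finset.Nat.sum_antidiagonal_eq_sum_range_succ_mk] at h
      rw [expCoeff_succ, ← mul_div_assoc, eq_div_iff hk, h, Finset.mul_sum]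
      refine Finset.sum_congr rfl fun i hi => ?_
      rw [ih i (Finset.mem_range.1 hi), PowerSeries.coeff_mk, mul_assoc]

lemma expSeries_add (L L' : ℕ → ℂ) :
    expSeries (fun l => L l + L' l) = expSeries L * expSeries L' := by
  have h : PowerSeries.derivative ℂ (expSeries L * expSeries L')
      = expSeries L * expSeries L' * PowerSeries.mk (fun l => L l + L' l) := by
    have : PowerSeries.mk (fun l => L l + L' l) = PowerSeries.mk L + PowerSeries.mk L' := by
      ext; simp
    rw [Derivation.leibniz, derivative_expSeries, derivative_expSeries, this]
    simp only [smul_eq_mul]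
    ring
  have := eq_C_mul_expSeries h
  simp at this
  exact this.symm

lemma expCoeff_add (L L' : ℕ → ℂ) (k : ℕ) :
    expCoeff (fun l => L l + L' l) k = ∑ i ∈ range (k + 1), expCoeff L i * expCoeff L' (k - i) := by
  rw [← coeff_expSeries, expSeries_add, PowerSeries.coeff_mul,
    Finset.Nat.sum_antidiagonal_eq_sum_range_succ_mk]
  simp

lemma expCoeff_homogeneous (L : ℕ → ℂ) (r : ℂ) (k : ℕ) :
    expCoeff (fun l => r ^ (l + 1) * L l) k = r ^ k * expCoeff L k := by
  induction k using Nat.strong_induction_on with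
  | _ k ih =>
    rcases k with _ | k
    · simp
    · rw [expCoeff_succ, expCoeff_succ, ← mul_div_assoc, Finset.mul_sum]
      congr 1
      refine Finset.sum_congr rfl fun i hi => ?_
      have hi' := Finset.mem_range.1 hi
      rw [ih i hi']
      have : r ^ (k + 1) = r ^ i * r ^ (k - i + 1) := by
        rw [← pow_add]; congr 1; omega
      rw [this]; ring

lemma tendsto_expCoeff {α : Type*} {F : Filter α} {L : α → ℕ → ℂ} {L' : ℕ → ℂ}
    (h : ∀ l, Filter.Tendsto (fun a => L a l) F (nhds (L' l))) (k : ℕ) :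
    Filter.Tendsto (fun a => expCoeff (L a) k) F (nhds (expCoeff L' k)) := by
  induction k using Nat.strong_induction_on with
  | _ k ih =>
    rcases k with _ | k
    · simpa using tendsto_const_nhds
    · simp only [expCoeff_succ]
      refine Filter.Tendsto.div_const (tendsto_finsetSum _ fun i hi => ?_) _
      exact (ih i (Finset.mem_range.1 hi)).mul (h _)

lemma contDiffAt_expCoeff {E : Type*} [NormedAddCommGroup E] [NormedSpace ℂ E] {L : E → ℕ → ℂ}
    {x : E} {n : WithTop ℕ∞} (h : ∀ l, ContDiffAt ℂ n (fun a => L a l) x) (k : ℕ) :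
    ContDiffAt ℂ n (fun a => expCoeff (L a) k) x := by
  induction k using Nat.strong_induction_on with
  | _ k ih =>
    rcases k with _ | k
    · simpa using contDiffAt_const
    · simp only [expCoeff_succ]
      refine ContDiffAt.div_const (ContDiffAt.sum fun i hi => ?_) _
      exact (ih i (Finset.mem_range.1 hi)).mul (h _)

/-- The derivative of the coefficients of `h = exp (∫ L)` along a path `L = L(η)`. -/
lemma hasDerivAt_expCoeff {L : ℂ → ℕ → ℂ} {Q : PowerSeries ℂ} {η : ℂ}
    (hQ : PowerSeries.constantCoeff Q = 0)
    (h : ∀ l, HasDerivAt (fun a => L a l) ((l + 1) * PowerSeries.coeff (l + 1) Q) η) (k : ℕ) :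
    HasDerivAt (fun a => expCoeff (L a) k) (PowerSeries.coeff k (expSeries (L η) * Q)) η := by
  induction k using Nat.strong_induction_on with
  | _ k ih =>
    rcases k with _ | k
    · simpa [hQ] using hasDerivAt_const η (1 : ℂ)
    · simp only [expCoeff_succ]
      have hk : (k : ℂ) + 1 ≠ 0 := Nat.cast_add_one_ne_zero k
      have := (HasDerivAt.fun_sum (u := range (k + 1)) fun i hi =>
        (ih i (Finset.mem_range.1 hi)).mul (h (k - i))).div_const ((k : ℂ) + 1)
      refine this.congr_deriv ?_
      rw [div_eq_iff hk, ← PowerSeries.coeff_derivative, Derivation.leibniz, derivative_expSeries]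
      simp only [smul_eq_mul, map_add]
      have e1 : expSeries (L η) * PowerSeries.derivative ℂ Q
          + Q * (expSeries (L η) * PowerSeries.mk (L η))
          = (expSeries (L η) * Q) * PowerSeries.mk (L η)
            + expSeries (L η) * PowerSeries.derivative ℂ Q := by ring
      rw [← map_add, e1, map_add, PowerSeries.coeff_mul _ (_ * Q),
        PowerSeries.coeff_mul _ _ (PowerSeries.derivative ℂ Q),
        Finset.Nat.sum_antidiagonal_eq_sum_range_succ_mk,
        Finset.Nat.sum_antidiagonal_eq_sum_range_succ_mk, ← Finset.sum_add_distrib]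
      refine Finset.sum_congr rfl fun i hi => ?_
      simp only [PowerSeries.coeff_mk, PowerSeries.coeff_derivative, coeff_expSeries]
      ring

section Local

variable {κ : Type*} [Fintype κ] [DecidableEq κ]

/-- The power sums `∑ σᵢ (qᵢ - z)^{-(l+1)}`: the Taylor coefficients at `z` of the logarithmic
derivative of `∏ (X - qᵢ)^{-σᵢ}`; a point `qᵢ = z` does not contribute. -/
noncomputable def powSum (σ q : κ → ℂ) (z : ℂ) (l : ℕ) : ℂ := ∑ i, σ i * ((q i - z)⁻¹) ^ (l + 1)

/-- Taylor expansion of a polynomial at `z`, as a power series. -/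
noncomputable def expand (z : ℂ) : Polynomial ℂ →+* PowerSeries ℂ :=
  Polynomial.coeToPowerSeries.ringHom.comp (Polynomial.taylorAlgHom z : _ →+* Polynomial ℂ)

lemma expand_X_sub_C (z a : ℂ) :
    expand z (Polynomial.X - Polynomial.C a) = PowerSeries.X + PowerSeries.C (z - a) := by
  simp [expand, Polynomial.taylor_X, Polynomial.taylor_C]
  ring

lemma expand_X_sub_C_self (z : ℂ) :
    expand z (Polynomial.X - Polynomial.C z) = PowerSeries.X := by
  simp [expand_X_sub_C]

@[simp] lemma expand_C (z a : ℂ) : expand z (Polynomial.C a) = PowerSeries.C a := by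
  simp [expand, Polynomial.taylor_C]

lemma constantCoeff_expand (z : ℂ) (A : Polynomial ℂ) :
    PowerSeries.constantCoeff (expand z A) = A.eval z := by
  simp [expand, Polynomial.taylor_apply, ← PowerSeries.coeff_zero_eq_constantCoeff_apply,
    Polynomial.coeff_zero_eq_eval_zero]

lemma derivative_expand (z : ℂ) (A : Polynomial ℂ) :
    PowerSeries.derivative ℂ (expand z A) = expand z (Polynomial.derivative A) := by
  simp [expand, PowerSeries.derivative_coe, Polynomial.taylor_apply, Polynomial.derivative_comp]

lemma X_sub_C_mul_geom (b : ℂ) (hb : b ≠ 0) :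
    (PowerSeries.X - PowerSeries.C b) * PowerSeries.mk (fun l => (b⁻¹) ^ (l + 1)) = -1 := by
  ext k
  rw [sub_mul, map_sub, PowerSeries.coeff_C_mul]
  rcases k with _ | k
  · simp [hb]
  · rw [PowerSeries.coeff_succ_X_mul]
    simp [PowerSeries.coeff_one]
    field_simp
    ring

/-- `∏_{i ∈ s} (X - qᵢ)`. -/
noncomputable def nodes (q : κ → ℂ) (s : Finset κ) : Polynomial ℂ :=
  ∏ i ∈ s, (Polynomial.X - Polynomial.C (q i))

lemma nodes_erase (q : κ → ℂ) {s : Finset κ} {j : κ} (hj : j ∈ s) :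
    nodes q s = (Polynomial.X - Polynomial.C (q j)) * nodes q (s.erase j) :=
  (Finset.mul_prod_erase s _ hj).symm

lemma derivative_nodes (q : κ → ℂ) (s : Finset κ) :
    Polynomial.derivative (nodes q s) = ∑ i ∈ s, nodes q (s.erase i) := by
  rw [nodes, Polynomial.derivative_prod_finset]
  simp [nodes]

lemma monic_nodes (q : κ → ℂ) (s : Finset κ) : (nodes q s).Monic :=
  Polynomial.monic_prod_of_monic _ _ fun _ _ => Polynomial.monic_X_sub_C _

lemma natDegree_nodes (q : κ → ℂ) (s : Finset κ) : (nodes q s).natDegree = #s := by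
  rw [nodes, Polynomial.natDegree_prod_of_monic _ _ fun i _ => Polynomial.monic_X_sub_C _]
  simp

lemma eval_nodes_ne_zero {q : κ → ℂ} (hq : Function.Injective q) {s : Finset κ} {j : κ}
    (hj : j ∉ s) : (nodes q s).eval (q j) ≠ 0 := by
  rw [nodes, Polynomial.eval_prod]
  refine Finset.prod_ne_zero_iff.2 fun i hi => ?_
  simp only [Polynomial.eval_sub, Polynomial.eval_X, Polynomial.eval_C, sub_ne_zero]
  exact fun h => hj (hq h ▸ hi)

lemma mk_powSum (σ q : κ → ℂ) (z : ℂ) :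
    PowerSeries.mk (powSum σ q z)
      = ∑ i, PowerSeries.C (σ i) * PowerSeries.mk (fun l => ((q i - z)⁻¹) ^ (l + 1)) := by
  ext k; simp [powSum]

lemma expand_nodes_mul_powSum {q : κ → ℂ} (hq : Function.Injective q) (σ : κ → ℂ) {j : κ}
    {s : Finset κ} (hjs : j ∉ s) (hσ : ∀ i, i ≠ j → i ∉ s → σ i = 0) :
    expand (q j) (nodes q s) * PowerSeries.mk (powSum σ q (q j))
      = - expand (q j) (∑ i ∈ s, Polynomial.C (σ i) * nodes q (s.erase i)) := by
  rw [mk_powSum, Finset.mul_sum, map_sum, ← Finset.sum_neg_distrib]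
  refine (Finset.sum_subset (Finset.subset_univ s) fun i _ hi => ?_).symm.trans
    (Finset.sum_congr rfl fun i hi => ?_)
  · rcases eq_or_ne i j with rfl | hij
    · rw [show PowerSeries.mk (fun l => ((q i - q i)⁻¹) ^ (l + 1)) = 0 by ext; simp, mul_zero,
        mul_zero]
    · rw [hσ i hij hi, map_zero, zero_mul, mul_zero]
  have hne : q i - q j ≠ 0 := sub_ne_zero.2 fun h => hjs (hq h ▸ hi)
  have h1 := X_sub_C_mul_geom _ hne
  have h2 : expand (q j) (Polynomial.X - Polynomial.C (q i))
      = PowerSeries.X - PowerSeries.C (q i - q j) := by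
    rw [expand_X_sub_C, ← neg_sub (q i) (q j), map_neg, ← sub_eq_add_neg]
  rw [nodes_erase q hi, map_mul, map_mul, expand_C, h2]
  linear_combination (PowerSeries.C (σ i) * expand (q j) (nodes q (s.erase i))) * h1

/-- Up to a nonzero factor, the residue at `qⱼ` of the form `A(z) ∏ (z - qᵢ)^{-σᵢ} dz`, where
`σⱼ = D + 1`. -/
noncomputable def locRes (σ q : κ → ℂ) (j : κ) (D : ℕ) (A : Polynomial ℂ) : ℂ :=
  PowerSeries.coeff D (expand (q j) A * expSeries (powSum σ q (q j)))

/-- `∏ (z - qᵢ)^{σᵢ}` times the derivative of `N(z) ∏ (z - qᵢ)^{1 - σᵢ}`. -/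
noncomputable def twistedDeriv (σ q : κ → ℂ) : Polynomial ℂ →ₗ[ℂ] Polynomial ℂ :=
  LinearMap.mulLeft ℂ (nodes q univ) ∘ₗ Polynomial.derivative
    + LinearMap.mulLeft ℂ (∑ i, Polynomial.C (1 - σ i) * nodes q (univ.erase i))

lemma twistedDeriv_apply (σ q : κ → ℂ) (N : Polynomial ℂ) :
    twistedDeriv σ q N = nodes q univ * Polynomial.derivative N
      + (∑ i, Polynomial.C (1 - σ i) * nodes q (univ.erase i)) * N := by
  simp [twistedDeriv]

/-- Exact forms have no residues. -/
lemma locRes_twistedDeriv {σ q : κ → ℂ} (hq : Function.Injective q) {j : κ} {D : ℕ}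
    (hD : σ j = D + 1) (N : Polynomial ℂ) : locRes σ q j D (twistedDeriv σ q N) = 0 := by
  set h := expSeries (powSum σ q (q j)) with hh
  set S := nodes q (univ.erase j) with hS
  set V := expand (q j) (N * S) * h with hV
  have key : expand (q j) (twistedDeriv σ q N) * h
      = PowerSeries.X * PowerSeries.derivative ℂ V - PowerSeries.C (D : ℂ) * V := by
    have e1 : nodes q univ = (Polynomial.X - Polynomial.C (q j)) * S :=
      nodes_erase q (Finset.mem_univ j)
    have e2 : ∑ i, Polynomial.C (1 - σ i) * nodes q (univ.erase i)
        = Polynomial.C (-(D : ℂ)) * S + (Polynomial.X - Polynomial.C (q j)) *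
          (Polynomial.derivative S
            - ∑ i ∈ univ.erase j, Polynomial.C (σ i) * nodes q ((univ.erase j).erase i)) := by
      rw [← Finset.add_sum_erase _ _ (Finset.mem_univ j), hD, hS, derivative_nodes,
        ← Finset.sum_sub_distrib, Finset.mul_sum]
      congr 1
      · congr 2; ring
      · refine Finset.sum_congr rfl fun i hi => ?_
        have : j ∈ univ.erase i :=
          Finset.mem_erase.2 ⟨(Finset.ne_of_mem_erase hi).symm, Finset.mem_univ j⟩
        rw [nodes_erase q this, Finset.erase_right_comm, map_sub, Polynomial.C_1]
        ring
    have e3 := expand_nodes_mul_powSum hq σ (Finset.notMem_erase j univ)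
      fun i hi hi' => absurd (Finset.mem_erase.2 ⟨hi, Finset.mem_univ i⟩) hi'
    rw [twistedDeriv_apply, e1, e2, hV, Derivation.leibniz, derivative_expSeries,
      derivative_expand, Polynomial.derivative_mul]
    simp only [smul_eq_mul, map_add (expand (q j)), map_mul (expand (q j)), expand_X_sub_C_self,
      expand_C, map_neg, ← hh]
    rw [map_sub (expand (q j)) (Polynomial.derivative S)]
    linear_combination (-PowerSeries.X * expand (q j) N * h) * e3
  rw [locRes, key, map_sub, PowerSeries.coeff_C_mul]
  rcases D with _ | D
  · simp
  · rw [PowerSeries.coeff_succ_X_mul, PowerSeries.coeff_derivative]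
    push_cast
    ring

lemma locRes_add (σ q : κ → ℂ) (j : κ) (D : ℕ) (A B : Polynomial ℂ) :
    locRes σ q j D (A + B) = locRes σ q j D A + locRes σ q j D B := by
  simp [locRes, add_mul]

lemma locRes_sum_smul {τ : Type*} (s : Finset τ) (σ q : κ → ℂ) (j : κ) (D : ℕ) (c : τ → ℂ)
    (A : τ → Polynomial ℂ) :
    locRes σ q j D (∑ k ∈ s, c k • A k) = ∑ k ∈ s, c k * locRes σ q j D (A k) := by
  simp [locRes, Finset.sum_mul, Polynomial.smul_eq_C_mul, mul_assoc]

/-- The form with a single simple pole at `qⱼ`. -/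
noncomputable def simplePole (q : κ → ℂ) (J : Finset κ) (D : κ → ℕ) (j : κ) : Polynomial ℂ :=
  (Polynomial.X - Polynomial.C (q j)) ^ D j
    * ∏ i ∈ J.erase j, (Polynomial.X - Polynomial.C (q i)) ^ (D i + 1)

lemma locRes_simplePole_of_ne (σ q : κ → ℂ) {J : Finset κ} {D : κ → ℕ} {i j : κ} (hj : j ∈ J)
    (hij : j ≠ i) : locRes σ q j (D j) (simplePole q J D i) = 0 := by
  have hj' : j ∈ J.erase i := Finset.mem_erase.2 ⟨hij, hj⟩
  rw [locRes, simplePole, ← Finset.mul_prod_erase _ _ hj', map_mul (expand (q j)),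
    map_mul (expand (q j)), map_pow (expand (q j)) _ (D j + 1), expand_X_sub_C_self, mul_left_comm,
    mul_assoc, PowerSeries.coeff_X_pow_mul', if_neg (by omega)]

lemma locRes_simplePole_self (σ : κ → ℂ) {q : κ → ℂ} (hq : Function.Injective q) {J : Finset κ}
    {D : κ → ℕ} {j : κ} : locRes σ q j (D j) (simplePole q J D j) ≠ 0 := by
  rw [locRes, simplePole, map_mul (expand (q j)), map_pow (expand (q j)), expand_X_sub_C_self, mul_assoc,
    PowerSeries.coeff_X_pow_mul', if_pos le_rfl, Nat.sub_self,
    PowerSeries.coeff_zero_eq_constantCoeff_apply,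
    map_mul PowerSeries.constantCoeff, constantCoeff_expSeries, mul_one,
    constantCoeff_expand, Polynomial.eval_prod]
  refine Finset.prod_ne_zero_iff.2 fun i hi => ?_
  simp only [Polynomial.eval_pow, Polynomial.eval_sub, Polynomial.eval_X, Polynomial.eval_C]
  exact pow_ne_zero _ (sub_ne_zero.2 fun h => (Finset.ne_of_mem_erase hi) (hq h).symm)

lemma natDegree_simplePole (q : κ → ℂ) {J : Finset κ} {D : κ → ℕ} {j : κ} (hj : j ∈ J) :
    (simplePole q J D j).natDegree + 1 = ∑ i ∈ J, (D i + 1) := by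
  have hm : ∀ i, (Polynomial.X - Polynomial.C (q i)).Monic := fun i => Polynomial.monic_X_sub_C _
  rw [simplePole, Polynomial.Monic.natDegree_mul ((hm j).pow _)
    (Polynomial.monic_prod_of_monic _ _ fun i _ => (hm i).pow _),
    Polynomial.natDegree_prod_of_monic _ _ fun i _ => (hm i).pow _,
    ← Finset.add_sum_erase _ _ hj]
  simp only [Polynomial.natDegree_pow, Polynomial.natDegree_X_sub_C]
  simp
  ring

lemma natDegree_sum_nodes_le [Nonempty κ] (σ q : κ → ℂ) :
    (∑ i, Polynomial.C (1 - σ i) * nodes q (univ.erase i)).natDegree ≤ Fintype.card κ - 1 := by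
  refine Polynomial.natDegree_sum_le_of_forall_le _ _ fun i _ => ?_
  refine (Polynomial.natDegree_C_mul_le _ _).trans ?_
  rw [natDegree_nodes, Finset.card_erase_of_mem (Finset.mem_univ _), Finset.card_univ]

lemma coeff_sum_nodes [Nonempty κ] (σ q : κ → ℂ) :
    (∑ i, Polynomial.C (1 - σ i) * nodes q (univ.erase i)).coeff (Fintype.card κ - 1)
      = Fintype.card κ - ∑ i, σ i := by
  have h : ∀ i : κ, (nodes q (univ.erase i)).coeff (Fintype.card κ - 1) = 1 := fun i => by
    have := (monic_nodes q (univ.erase i)).coeff_natDegree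
    rwa [natDegree_nodes, Finset.card_erase_of_mem (Finset.mem_univ _), Finset.card_univ] at this
  simp only [Polynomial.finsetSum_coeff, Polynomial.coeff_C_mul, h, mul_one,
    Finset.sum_sub_distrib, Finset.sum_const, Finset.card_univ, nsmul_eq_mul]

lemma natDegree_twistedDeriv_le [Nonempty κ] (σ q : κ → ℂ) (N : Polynomial ℂ) :
    (twistedDeriv σ q N).natDegree ≤ Fintype.card κ - 1 + N.natDegree := by
  have hc : 1 ≤ Fintype.card κ := Fintype.card_pos
  rw [twistedDeriv_apply]
  refine Polynomial.natDegree_add_le_of_degree_le ?_ ?_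
  · rcases Nat.eq_zero_or_pos N.natDegree with h | h
    · rw [Polynomial.derivative_of_natDegree_zero h]; simp
    · refine Polynomial.natDegree_mul_le.trans ?_
      have := Polynomial.natDegree_derivative_le N
      rw [natDegree_nodes, Finset.card_univ]
      omega
  · exact Polynomial.natDegree_mul_le.trans
      (Nat.add_le_add_right (natDegree_sum_nodes_le σ q) _)

lemma coeff_twistedDeriv [Nonempty κ] (σ q : κ → ℂ) (N : Polynomial ℂ) :
    (twistedDeriv σ q N).coeff (Fintype.card κ - 1 + N.natDegree)
      = (N.natDegree + Fintype.card κ - ∑ i, σ i) * N.leadingCoeff := by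
  have hc : 1 ≤ Fintype.card κ := Fintype.card_pos
  rw [twistedDeriv_apply, Polynomial.coeff_add,
    Polynomial.coeff_mul_add_eq_of_natDegree_le (natDegree_sum_nodes_le σ q) le_rfl,
    coeff_sum_nodes]
  have : (nodes q univ * Polynomial.derivative N).coeff (Fintype.card κ - 1 + N.natDegree)
      = N.natDegree * N.leadingCoeff := by
    rcases Nat.eq_zero_or_pos N.natDegree with h | h
    · rw [Polynomial.derivative_of_natDegree_zero h]; simp [h]
    · have e : Fintype.card κ - 1 + N.natDegree = Fintype.card κ + (N.natDegree - 1) := by omega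
      have hS := (monic_nodes q univ).coeff_natDegree
      rw [natDegree_nodes, Finset.card_univ] at hS
      rw [e, Polynomial.coeff_mul_add_eq_of_natDegree_le
        (by rw [natDegree_nodes, Finset.card_univ]) (Polynomial.natDegree_derivative_le N), hS,
        Polynomial.coeff_derivative, one_mul, Nat.sub_add_cancel h]
      push_cast [Nat.cast_sub h]
      rw [Polynomial.leadingCoeff]; ring
  rw [this, Polynomial.leadingCoeff]
  ring

/-- Residue-free forms of small degree are linearly dependent as soon as there are enough of
them. -/
lemma exists_relation [Nonempty κ] {q : κ → ℂ} (hq : Function.Injective q) {σ : κ → ℂ}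
    {J : Finset κ} {D : κ → ℕ} (hD : ∀ j ∈ J, σ j = D j + 1) {m : ℕ}
    (hdeg : ∀ ν < m, (ν : ℂ) + Fintype.card κ - ∑ i, σ i ≠ 0)
    (hJ : ∑ j ∈ J, (D j + 1) ≤ m + (Fintype.card κ - 1))
    {τ : Type*} [Fintype τ] (A : τ → Polynomial ℂ)
    (hcard : Fintype.card κ ≤ Fintype.card τ + #J)
    (hA : ∀ k, (A k).degree < (Fintype.card κ - 1 : ℕ))
    (hres : ∀ k, ∀ j ∈ J, locRes σ q j (D j) (A k) = 0) :
    ∃ c : τ → ℂ, c ≠ 0 ∧ ∑ k, c k • A k = 0 := by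
  have hc : 1 ≤ Fintype.card κ := Fintype.card_pos
  let B : J → Polynomial ℂ := fun j => simplePole q J D j
  let Φ : (Polynomial.degreeLT ℂ m × (τ → ℂ) × (J → ℂ)) →ₗ[ℂ] Polynomial ℂ :=
    (twistedDeriv σ q ∘ₗ (Polynomial.degreeLT ℂ m).subtype).coprod
      ((Fintype.linearCombination ℂ A).coprod (Fintype.linearCombination ℂ B))
  have hΦ : ∀ x, Φ x ∈ Polynomial.degreeLT ℂ (m + (Fintype.card κ - 1)) := by
    rintro ⟨⟨N, hN⟩, c, r⟩
    simp only [Φ, LinearMap.coprod_apply, LinearMap.comp_apply, Submodule.subtype_apply,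
      Fintype.linearCombination_apply]
    refine add_mem ?_ (add_mem ?_ ?_)
    · rcases eq_or_ne N 0 with rfl | h0
      · simp
      · rw [Polynomial.mem_degreeLT] at hN ⊢
        have h1 := (Polynomial.natDegree_lt_iff_degree_lt h0).2 hN
        have h2 := natDegree_twistedDeriv_le σ q N
        refine Polynomial.degree_le_natDegree.trans_lt ?_
        exact_mod_cast (by omega : (twistedDeriv σ q N).natDegree < m + (Fintype.card κ - 1))
    · refine Submodule.sum_mem _ fun k _ => Submodule.smul_mem _ _ ?_
      rw [Polynomial.mem_degreeLT]
      refine (hA k).trans_le ?_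
      exact_mod_cast Nat.le_add_left _ _
    · refine Submodule.sum_mem _ fun k _ => Submodule.smul_mem _ _ ?_
      rw [Polynomial.mem_degreeLT]
      refine Polynomial.degree_le_natDegree.trans_lt ?_
      have := natDegree_simplePole q (D := D) k.2
      exact_mod_cast (by simp only [B]; omega :
        (B k).natDegree < m + (Fintype.card κ - 1))
  have hfin : ∀ r, Module.finrank ℂ (Polynomial.degreeLT ℂ r) = r := fun r => by
    rw [(Polynomial.degreeLTEquiv ℂ r).finrank_eq]; simp
  have hfd : ∀ r, FiniteDimensional ℂ (Polynomial.degreeLT ℂ r) := fun r =>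
    (Polynomial.degreeLTEquiv ℂ r).symm.finiteDimensional
  have := hfd m
  have := hfd (m + (Fintype.card κ - 1))
  have hker := LinearMap.ker_ne_bot_of_finrank_lt (f := Φ.codRestrict _ hΦ) (by
    rw [hfin, Module.finrank_prod, Module.finrank_prod, hfin]
    simp only [Module.finrank_fintype_fun_eq_card, Fintype.card_coe]
    omega)
  obtain ⟨⟨⟨N, hN⟩, c, r⟩, hx, hx0⟩ := Submodule.exists_mem_ne_zero_of_ne_bot hker
  have hx' : Φ (⟨N, hN⟩, c, r) = 0 := congrArg Subtype.val (LinearMap.mem_ker.1 hx)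
  simp only [Φ, LinearMap.coprod_apply, LinearMap.comp_apply, Submodule.subtype_apply,
      Fintype.linearCombination_apply] at hx'
  have hr : r = 0 := by
    funext j
    have := congrArg (locRes σ q j (D j)) hx'
    rw [locRes_add, locRes_add, locRes_twistedDeriv hq (hD j j.2), locRes_sum_smul,
      locRes_sum_smul, Finset.sum_eq_zero fun k _ => by rw [hres k j j.2, mul_zero],
      Finset.sum_eq_single j] at this
    · rw [zero_add, zero_add, show locRes σ q j (D j) 0 = 0 by simp [locRes]] at this
      exact (mul_eq_zero.1 this).resolve_right (locRes_simplePole_self σ hq)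
    · intro i _ hi
      rw [locRes_simplePole_of_ne σ q j.2 fun h => hi (Subtype.ext h.symm), mul_zero]
    · simp
  subst hr
  simp only [Pi.zero_apply, zero_smul, Finset.sum_const_zero, add_zero] at hx'
  have hN0 : N = 0 := by
    by_contra h0
    have h1 := congrArg (fun p => p.coeff (Fintype.card κ - 1 + N.natDegree)) hx'
    have h2 : (∑ k, c k • A k).coeff (Fintype.card κ - 1 + N.natDegree) = 0 := by
      rw [Polynomial.finsetSum_coeff]
      refine Finset.sum_eq_zero fun k _ => ?_
      rw [Polynomial.coeff_smul, Polynomial.coeff_eq_zero_of_degree_lt, smul_zero]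
      refine (hA k).trans_le ?_
      exact_mod_cast Nat.le_add_right _ _
    simp only [Polynomial.coeff_add, h2, coeff_twistedDeriv, add_zero, Polynomial.coeff_zero,
      mul_eq_zero, Polynomial.leadingCoeff_eq_zero, h0, or_false] at h1
    rw [Polynomial.mem_degreeLT] at hN
    exact hdeg _ ((Polynomial.natDegree_lt_iff_degree_lt h0).2 hN) h1
  subst hN0
  refine ⟨c, fun h => hx0 ?_, by simpa using hx'⟩
  simp [h]

end Local

section Infinitesimal

variable {κ : Type*} [Fintype κ] [DecidableEq κ]

lemma powSum_add_left (σ σ' q : κ → ℂ) (z : ℂ) (l : ℕ) :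
    powSum (σ + σ') q z l = powSum σ q z l + powSum σ' q z l := by
  simp [powSum, add_mul, Finset.sum_add_distrib]

/-- The first-order variation of the power series attached to the point `qⱼ` when the points move
with velocities `v`. -/
noncomputable def variation (σ q v : κ → ℂ) (j : κ) : PowerSeries ℂ :=
  expSeries (powSum σ q (q j)) * (PowerSeries.C (v j) * PowerSeries.mk (powSum σ q (q j))
    - PowerSeries.mk (powSum (σ * v) q (q j)))

lemma hasDerivAt_powSum (σ : κ → ℂ) {q : ℂ → κ → ℂ} {v : κ → ℂ} {η : ℂ}
    (hq : Function.Injective (q η)) (hv : ∀ i, HasDerivAt (fun a => q a i) (v i) η) (j : κ)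
    (l : ℕ) :
    HasDerivAt (fun a => powSum σ (q a) (q a j) l)
      ((l + 1) * (v j * powSum σ (q η) (q η j) (l + 1)
        - powSum (σ * v) (q η) (q η j) (l + 1))) η := by
  have hterm : ∀ i, HasDerivAt (fun a => σ i * ((q a i - q a j)⁻¹) ^ (l + 1))
      (σ i * (-(l + 1) * (v i - v j) * ((q η i - q η j)⁻¹) ^ (l + 2))) η := by
    intro i
    rcases eq_or_ne i j with rfl | hij
    · simpa using hasDerivAt_const η (0 : ℂ)
    · have hne : q η i - q η j ≠ 0 := sub_ne_zero.2 fun h => hij (hq h)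
      refine (((((hv i).sub (hv j)).inv hne).pow (l + 1)).const_mul (σ i)).congr_deriv ?_
      simp only [Pi.sub_apply, Pi.inv_apply]
      push_cast [Nat.add_sub_cancel]
      rw [pow_add _ l 2, inv_pow _ 2]
      field_simp
  refine (HasDerivAt.fun_sum fun i _ => hterm i).congr_deriv ?_
  simp only [powSum, Finset.mul_sum, ← Finset.sum_sub_distrib, Pi.mul_apply]
  exact Finset.sum_congr rfl fun i _ => by ring

lemma hasDerivAt_expCoeff_powSum (σ : κ → ℂ) {q : ℂ → κ → ℂ} {v : κ → ℂ} {η : ℂ}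
    (hq : Function.Injective (q η)) (hv : ∀ i, HasDerivAt (fun a => q a i) (v i) η) (j : κ)
    (k : ℕ) (hk : expCoeff (powSum σ (q η) (q η j)) k = 0) :
    HasDerivAt (fun a => expCoeff (powSum σ (q a) (q a j)) k)
      (PowerSeries.coeff k (variation σ (q η) v j)) η := by
  set W := PowerSeries.C (v j) * PowerSeries.mk (powSum σ (q η) (q η j))
    - PowerSeries.mk (powSum (σ * v) (q η) (q η j)) with hW
  have := hasDerivAt_expCoeff (L := fun a => powSum σ (q a) (q a j)) (η := η)
    (Q := W - PowerSeries.C (PowerSeries.constantCoeff W)) (by simp) (fun l => by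
      refine (hasDerivAt_powSum σ hq hv j l).congr_deriv ?_
      rw [map_sub, PowerSeries.coeff_C, if_neg l.succ_ne_zero, hW]
      simp) k
  refine this.congr_deriv ?_
  rw [mul_sub, map_sub, mul_comm _ (PowerSeries.C _), PowerSeries.coeff_C_mul, coeff_expSeries, hk,
    mul_zero, sub_zero, variation, ← hW]

/-- A first-order deformation with no residue variation is trivial. -/
lemma eq_zero_of_variation {q : κ → ℂ} (hq : Function.Injective q) {σ v : κ → ℂ} {J : Finset κ}
    {d : κ → ℕ} (hd : ∀ j ∈ J, 1 ≤ d j) (hσ : ∀ j ∈ J, σ j = d j)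
    (hJ : Fintype.card κ = #J + 2) {m : ℕ} (hm : ∑ i, σ i = m + 2 + ∑ j ∈ J, (d j : ℂ))
    (hres : ∀ j ∈ J, expCoeff (powSum σ q (q j)) (d j - 1) = 0)
    (hv : ∀ i ∉ J, v i = 0)
    (hvar : ∀ j ∈ J, PowerSeries.coeff (d j - 1) (variation σ q v j) = 0) : v = 0 := by
  have : Nonempty κ := Fintype.card_pos_iff.1 (by omega)
  set χ : κ → ℂ := fun i => if i ∈ J then 1 else 0 with hχ
  have hPh : ∀ j ∈ J, expand (q j) (nodes q (J.erase j)) * expSeries (powSum (σ + χ) q (q j))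
      = PowerSeries.C ((nodes q (J.erase j)).eval (q j)) * expSeries (powSum σ q (q j)) := by
    intro j hj
    have h1 := expand_nodes_mul_powSum hq χ (Finset.notMem_erase j J) (fun i hi hi' =>
      if_neg fun h => hi' (Finset.mem_erase.2 ⟨hi, h⟩))
    have h2 : ∑ i ∈ J.erase j, Polynomial.C (χ i) * nodes q ((J.erase j).erase i)
        = Polynomial.derivative (nodes q (J.erase j)) := by
      rw [derivative_nodes]
      refine Finset.sum_congr rfl fun i hi => ?_
      simp [hχ, Finset.mem_of_mem_erase hi]
    rw [h2] at h1
    have h3 : PowerSeries.mk (powSum (σ + χ) q (q j))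
        = PowerSeries.mk (powSum σ q (q j)) + PowerSeries.mk (powSum χ q (q j)) := by
      ext l; simp [powSum_add_left]
    have h4 := eq_C_mul_expSeries (L := powSum σ q (q j))
      (y := expand (q j) (nodes q (J.erase j)) * expSeries (powSum (σ + χ) q (q j))) (by
        rw [Derivation.leibniz, derivative_expSeries, derivative_expand, h3]
        simp only [smul_eq_mul]
        linear_combination expSeries (powSum (σ + χ) q (q j)) * h1)
    rwa [map_mul PowerSeries.constantCoeff, constantCoeff_expSeries, mul_one,
      constantCoeff_expand] at h4
  set A : Bool → Polynomial ℂ := fun b => bif b then nodes q J else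
    ∑ i ∈ J, Polynomial.C (σ i * v i) * nodes q (J.erase i) with hA
  have hA1 : ∀ j ∈ J, locRes (σ + χ) q j (d j) (nodes q J) = 0 := by
    intro j hj
    rw [locRes, nodes_erase q hj, map_mul (expand (q j)), expand_X_sub_C_self, mul_assoc, hPh j hj,
      ← Nat.sub_add_cancel (hd j hj), PowerSeries.coeff_succ_X_mul, PowerSeries.coeff_C_mul,
      coeff_expSeries, hres j hj, mul_zero]
  have hA2 : ∀ j ∈ J, locRes (σ + χ) q j (d j)
      (∑ i ∈ J, Polynomial.C (σ i * v i) * nodes q (J.erase i)) = 0 := by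
    intro j hj
    have h1 := expand_nodes_mul_powSum hq (σ * v) (Finset.notMem_erase j J) (fun i hi hi' => by
      rw [Pi.mul_apply, hv i fun h => hi' (Finset.mem_erase.2 ⟨hi, h⟩), mul_zero])
    have h2 : ∑ i ∈ J, Polynomial.C (σ i * v i) * nodes q (J.erase i)
        = Polynomial.C (σ j * v j) * nodes q (J.erase j) + (Polynomial.X - Polynomial.C (q j)) *
          ∑ i ∈ J.erase j, Polynomial.C ((σ * v) i) * nodes q ((J.erase j).erase i) := by
      rw [← Finset.add_sum_erase _ _ hj, Finset.mul_sum]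
      congr 1
      refine Finset.sum_congr rfl fun i hi => ?_
      have : j ∈ J.erase i := Finset.mem_erase.2 ⟨(Finset.ne_of_mem_erase hi).symm, hj⟩
      rw [nodes_erase q this, Finset.erase_right_comm, Pi.mul_apply]
      ring
    have h3 : expand (q j) (∑ i ∈ J, Polynomial.C (σ i * v i) * nodes q (J.erase i))
          * expSeries (powSum (σ + χ) q (q j))
        = PowerSeries.C ((nodes q (J.erase j)).eval (q j)) *
          (PowerSeries.C (σ j * v j) * expSeries (powSum σ q (q j)) - PowerSeries.X *
            (PowerSeries.mk (powSum (σ * v) q (q j)) * expSeries (powSum σ q (q j)))) := by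
      rw [h2, map_add (expand (q j)), map_mul (expand (q j)), map_mul (expand (q j)), expand_C,
        expand_X_sub_C_self]
      have h4 := hPh j hj
      linear_combination (PowerSeries.C (σ j * v j)
        - PowerSeries.X * PowerSeries.mk (powSum (σ * v) q (q j))) * h4
        + PowerSeries.X * expSeries (powSum (σ + χ) q (q j)) * h1
    have h5 := hvar j hj
    have h6 : variation σ q v j = PowerSeries.C (v j)
        * PowerSeries.derivative ℂ (expSeries (powSum σ q (q j)))
        - PowerSeries.mk (powSum (σ * v) q (q j)) * expSeries (powSum σ q (q j)) := by
      rw [variation, derivative_expSeries]; ring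
    rw [h6, map_sub, PowerSeries.coeff_C_mul, PowerSeries.coeff_derivative] at h5
    rw [locRes, h3, PowerSeries.coeff_C_mul, map_sub, PowerSeries.coeff_C_mul, hσ j hj]
    obtain ⟨e, he⟩ : ∃ e, d j = e + 1 := ⟨d j - 1, (Nat.sub_add_cancel (hd j hj)).symm⟩
    rw [he, Nat.add_sub_cancel] at h5
    rw [he, PowerSeries.coeff_succ_X_mul]
    push_cast
    linear_combination (Polynomial.eval (q j) (nodes q (J.erase j))) * h5
  have hA2deg : (∑ i ∈ J, Polynomial.C (σ i * v i) * nodes q (J.erase i)).degree < (#J : ℕ) := by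
    refine (Polynomial.degree_sum_le _ _).trans_lt ((Finset.sup_lt_iff ?_).2 fun i hi => ?_)
    · exact_mod_cast WithBot.bot_lt_coe _
    · refine Polynomial.degree_le_natDegree.trans_lt ?_
      have h1 := Polynomial.natDegree_C_mul_le (σ i * v i) (nodes q (J.erase i))
      rw [natDegree_nodes, Finset.card_erase_of_mem hi] at h1
      have := Finset.card_pos.2 ⟨i, hi⟩
      exact_mod_cast (by omega :
        (Polynomial.C (σ i * v i) * nodes q (J.erase i)).natDegree < #J)
  have hA1deg : (nodes q J).degree = (#J : ℕ) := by
    rw [Polynomial.degree_eq_natDegree (monic_nodes q J).ne_zero, natDegree_nodes]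
  have hχs : ∑ i, (σ + χ) i = m + 2 + ∑ j ∈ J, (d j : ℂ) + #J := by
    simp only [Pi.add_apply, Finset.sum_add_distrib, hm, hχ]
    simp
  obtain ⟨c, hc0, hc⟩ := exists_relation hq (σ := σ + χ) (J := J) (D := d) (m := m + ∑ j ∈ J, d j)
    (fun j hj => by simp [hχ, hj, hσ j hj])
    (fun ν hν h => by
      rw [hχs, hJ] at h
      have h1 : (ν : ℂ) = ((m + ∑ j ∈ J, d j : ℕ) : ℂ) := by
        push_cast at h ⊢
        linear_combination h
      exact hν.ne (by exact_mod_cast h1))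
    (by rw [hJ, Finset.sum_add_distrib]; simp; omega) A
    (by simp [hJ, add_comm])
    (fun k => by
      rw [hJ]
      cases k
      · exact hA2deg.trans (by exact_mod_cast (by omega : #J < #J + 2 - 1))
      · simp only [hA, cond_true, hA1deg]
        exact_mod_cast (by omega : #J < #J + 2 - 1))
    (fun k j hj => by
      cases k
      · exact hA2 j hj
      · exact hA1 j hj)
  simp only [Fintype.univ_bool, Finset.mem_singleton, Bool.true_eq_false, not_false_eq_true,
    Finset.sum_insert, Finset.sum_singleton, hA, cond_true, cond_false] at hc
  have hc1 : c true = 0 := by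
    have := congrArg (fun p => p.coeff #J) hc
    have h2 := (monic_nodes q J).coeff_natDegree
    rw [natDegree_nodes] at h2
    simp only [Polynomial.coeff_add, Polynomial.coeff_smul, h2, Polynomial.coeff_zero,
      Polynomial.coeff_eq_zero_of_degree_lt hA2deg] at this
    simpa using this
  have hc2 : c false ≠ 0 := fun h => hc0 (by funext b; cases b <;> assumption)
  rw [hc1, zero_smul, zero_add, smul_eq_zero, or_iff_right hc2] at hc
  funext j
  by_cases hj : j ∈ J
  · have h1 := congrArg (Polynomial.eval (q j)) hc
    rw [Polynomial.eval_finsetSum, Finset.sum_eq_single_of_mem j hj, Polynomial.eval_mul,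
      Polynomial.eval_C, Polynomial.eval_zero, mul_eq_zero,
      or_iff_left (eval_nodes_ne_zero hq (Finset.notMem_erase j J)), hσ j hj, mul_eq_zero] at h1
    · refine h1.resolve_left ?_
      have := hd j hj
      exact_mod_cast (by omega : d j ≠ 0)
    · intro i hi hij
      rw [nodes_erase q (Finset.mem_erase.2 ⟨hij.symm, hj⟩)]
      simp
  · exact hv j hj

end Infinitesimal

/-- There is no residue-free form with a single further singularity, at the origin, of positive
order. -/
lemma not_forall_expCoeff_eq_zero {S : Type*} [Fintype S] [DecidableEq S] [Nonempty S] {s : S → ℂ}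
    (hs : Function.Injective s) (hs0 : ∀ i, s i ≠ 0) {d : S → ℕ} (hd : ∀ i, 1 ≤ d i) {B : ℝ}
    (hB : 0 < B)
    (h : ∀ j, expCoeff (powSum (Option.elim' (B : ℂ) fun i => (d i : ℂ)) (Option.elim' 0 s) (s j))
      (d j - 1) = 0) : False := by
  have hq : Function.Injective (Option.elim' (0 : ℂ) s) := by
    rintro (_ | i) (_ | j) hij
    · rfl
    · exact absurd hij.symm (hs0 j)
    · exact absurd hij (hs0 i)
    · exact congrArg some (hs hij)
  have hle : Fintype.card S ≤ ∑ i, d i := by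
    rw [← Finset.card_univ, Finset.card_eq_sum_ones]
    exact Finset.sum_le_sum fun i _ => hd i
  obtain ⟨c, hc0, hc⟩ := exists_relation hq (σ := Option.elim' (B : ℂ) fun i => (d i : ℂ))
    (J := univ.map Function.Embedding.some) (D := Option.elim' 0 fun i => d i - 1)
    (m := ∑ i, d i - Fintype.card S)
    (by
      intro j hj
      obtain ⟨i, -, rfl⟩ := Finset.mem_map.1 hj
      simp [Nat.cast_sub (hd i)])
    (fun ν hν h0 => by
      rw [Fintype.sum_option, Fintype.card_option] at h0
      have h1 : ((ν : ℝ) + ((Fintype.card S : ℝ) + 1) - (B + ∑ i, (d i : ℝ)) : ℝ) = 0 := by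
        have : (((ν : ℝ) + ((Fintype.card S : ℝ) + 1) - (B + ∑ i, (d i : ℝ)) : ℝ) : ℂ) = 0 := by
          push_cast at h0 ⊢
          simpa using h0
        exact_mod_cast this
      have h2 : ((ν + 1 + Fintype.card S : ℕ) : ℝ) ≤ ((∑ i, d i : ℕ) : ℝ) :=
        Nat.cast_le.2 (by omega)
      push_cast at h2
      linarith)
    (by
      simp only [Finset.sum_map, Function.Embedding.some_apply, Option.elim'_some,
        Nat.sub_add_cancel (hd _), Fintype.card_option]
      omega) (τ := Unit) (fun _ => 1) (by simp)
    (fun _ => by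
      rw [Fintype.card_option, Nat.add_sub_cancel, Polynomial.degree_one]
      exact_mod_cast Fintype.card_pos)
    (by
      intro _ j hj
      obtain ⟨i, -, rfl⟩ := Finset.mem_map.1 hj
      simpa [locRes] using h i)
  apply hc0
  funext u
  simpa using hc

section Ultra

variable {α : Type*} (𝒰 : Ultrafilter α)

lemma exists_tendsto_of_bounded {f : α → ℂ} {C : ℝ} (h : ∀ᶠ a in 𝒰, ‖f a‖ ≤ C) :
    ∃ z, Tendsto f 𝒰 (𝓝 z) := by
  obtain ⟨z, -, hz⟩ := (isCompact_closedBall (0 : ℂ) C).ultrafilter_le_nhds (𝒰.map f)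
    (by
      refine le_principal_iff.2 (h.mono fun a ha => ?_)
      simpa using ha)
  exact ⟨z, hz⟩

lemma exists_tendsto_or_cobounded (f : α → ℂ) :
    (∃ z, Tendsto f 𝒰 (𝓝 z)) ∨ Tendsto f 𝒰 (Bornology.cobounded ℂ) := by
  by_cases h : ∃ C, ∀ᶠ a in 𝒰, ‖f a‖ ≤ C
  · exact .inl (exists_tendsto_of_bounded 𝒰 h.choose_spec)
  · push Not at h
    refine .inr (tendsto_norm_atTop_iff_cobounded.1 (tendsto_atTop.2 fun C => ?_))
    exact (h C).mono fun a ha => ha.le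

lemma exists_eventually_le {β : Type*} {P : Finset β} (hP : P.Nonempty) (f : α → β → ℝ) :
    ∃ b ∈ P, ∀ᶠ a in 𝒰, ∀ b' ∈ P, f a b ≤ f a b' := by
  have h : ∀ᶠ a in 𝒰, ∃ b ∈ (P : Set β), ∀ b' ∈ P, f a b ≤ f a b' :=
    Eventually.of_forall fun a => P.exists_min_image (f a) hP
  obtain ⟨b, hb, hb'⟩ := (Ultrafilter.eventually_exists_mem_iff P.finite_toSet).1 h
  exact ⟨b, hb, hb'⟩

end Ultra

lemma tendsto_cobounded_sub {α : Type*} {F : Filter α} {f g : α → ℂ} {z : ℂ}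
    (hf : Tendsto f F (Bornology.cobounded ℂ)) (hg : Tendsto g F (𝓝 z)) :
    Tendsto (fun a => f a - g a) F (Bornology.cobounded ℂ) := by
  refine tendsto_norm_atTop_iff_cobounded.1 (tendsto_atTop_mono (fun a => norm_sub_norm_le _ _) ?_)
  simpa only [sub_eq_add_neg] using
    (tendsto_norm_atTop_iff_cobounded.2 hf).atTop_add hg.norm.neg

section Solutions

variable {ι : Type*} [Fintype ι] [DecidableEq ι]

/-- The finite marked points: `0`, `1` and the `tᵢ`. -/
def pts (t : ι → ℂ) : Option (Option ι) → ℂ := Option.elim' 0 (Option.elim' 1 t)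

/-- The orders of the poles at `0`, `1` and the `tᵢ`. -/
def wts (m : ℕ) (d : ι → ℕ) (γ : ℂ) : Option (Option ι) → ℂ :=
  Option.elim' (m + 2 - γ) (Option.elim' γ fun i => (d i : ℂ))

/-- The configurations with no residues at the `tᵢ`. -/
def Sol (m : ℕ) (d : ι → ℕ) (γ : ℂ) : Set (ι → ℂ) :=
  {t | Function.Injective (pts t) ∧
    ∀ j, expCoeff (powSum (wts m d γ) (pts t) (t j)) (d j - 1) = 0}

lemma injective_pts {t : ι → ℂ} :
    Function.Injective (pts t) ↔ Function.Injective t ∧ (∀ i, t i ≠ 0) ∧ ∀ i, t i ≠ 1 := by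
  constructor
  · intro h
    refine ⟨fun i j hij => ?_, fun i hi => ?_, fun i hi => ?_⟩
    · simpa using h (a₁ := some (some i)) (a₂ := some (some j)) hij
    · simpa using h (a₁ := some (some i)) (a₂ := none) hi
    · simpa using h (a₁ := some (some i)) (a₂ := some none) hi
  · rintro ⟨h, h0, h1⟩ (_ | _ | i) (_ | _ | j) hij
    · rfl
    · simp [pts] at hij
    · exact absurd hij.symm (h0 j)
    · simp [pts] at hij
    · rfl
    · exact absurd hij.symm (h1 j)
    · exact absurd hij (h0 i)
    · exact absurd hij (h1 i)
    · rw [h hij]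

lemma expCoeff_powSum_affine {κ : Type*} [Fintype κ] (σ q : κ → ℂ) (z c δ : ℂ) (k : ℕ) :
    expCoeff (powSum σ (fun i => (q i - c) / δ) ((z - c) / δ)) k
      = δ ^ k * expCoeff (powSum σ q z) k := by
  rw [← expCoeff_homogeneous]
  refine congrArg (fun L => expCoeff L k) (funext fun l => ?_)
  rw [powSum, powSum, Finset.mul_sum]
  refine Finset.sum_congr rfl fun i _ => ?_
  rw [← sub_div, sub_sub_sub_cancel_right, inv_div, div_eq_mul_inv, mul_pow]
  ring

variable {α : Type*} {𝒰 : Ultrafilter α} {m : ℕ} {d : ι → ℕ} {γ : α → ℝ} {γ₀ : ℝ} {t : α → ι → ℂ}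

/-- No bubbles: the marked points cannot cluster at a scale at which all poles that stay at a
finite nonzero distance from the centre are distinct. -/
lemma no_bubble (hd : ∀ i, 1 ≤ d i) (hγ : Tendsto γ 𝒰 (𝓝 γ₀)) (h0 : 0 ≤ γ₀) (h2 : γ₀ < m + 2)
    (ht : ∀ᶠ a in 𝒰, t a ∈ Sol m d (γ a)) (c δ : α → ℂ)
    (hinj : ∀ i k z, k ≠ some (some i) → Tendsto (fun a => (t a i - c a) / δ a) 𝒰 (𝓝 z) →
      Tendsto (fun a => (pts (t a) k - c a) / δ a) 𝒰 (𝓝 z) → z = 0)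
    (hzero : ∀ z, Tendsto (fun a => (0 - c a) / δ a) 𝒰 (𝓝 z) → z = 0)
    (hone : ∀ z, Tendsto (fun a => (1 - c a) / δ a) 𝒰 (𝓝 z) → z = 0 ∨ γ₀ = 0)
    (hS : ∃ i z, z ≠ 0 ∧ Tendsto (fun a => (t a i - c a) / δ a) 𝒰 (𝓝 z))
    (hO : ∃ k, (k = some none → 0 < γ₀) ∧
      Tendsto (fun a => (pts (t a) k - c a) / δ a) 𝒰 (𝓝 0)) : False := by
  classical
  set p : α → Option (Option ι) → ℂ := fun a k => (pts (t a) k - c a) / δ a with hp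
  set τ : Option (Option ι) → ℝ := Option.elim' (m + 2 - γ₀) (Option.elim' γ₀ fun i => (d i : ℝ))
    with hτ
  have hτ0 : ∀ k, 0 ≤ τ k := by
    rintro (_ | _ | i)
    · simp only [hτ, Option.elim'_none]; linarith
    · exact h0
    · exact Nat.cast_nonneg _
  have hw : ∀ k, Tendsto (fun a => wts m d (γ a) k) 𝒰 (𝓝 (τ k)) := by
    have hγ' : Tendsto (fun a => (γ a : ℂ)) 𝒰 (𝓝 γ₀) :=
      (Complex.continuous_ofReal.tendsto _).comp hγ
    rintro (_ | _ | i)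
    · simpa [wts, hτ] using hγ'.const_sub (m + 2 : ℂ)
    · simpa [wts, hτ] using hγ'
    · simp [wts, hτ]
  let fin : Option (Option ι) → Prop := fun k => ∃ z, Tendsto (fun a => p a k) 𝒰 (𝓝 z)
  have hfin : ∀ k, ∃ z, fin k → Tendsto (fun a => p a k) 𝒰 (𝓝 z) := fun k => by
    by_cases h : fin k
    · exact ⟨h.choose, fun _ => h.choose_spec⟩
    · exact ⟨0, fun h' => absurd h' h⟩
  choose y hy using hfin
  have hinf : ∀ k, ¬ fin k → Tendsto (fun a => p a k) 𝒰 (Bornology.cobounded ℂ) := fun k hk =>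
    (exists_tendsto_or_cobounded 𝒰 _).resolve_left hk
  have huniq : ∀ k z, Tendsto (fun a => p a k) 𝒰 (𝓝 z) → z = y k := fun k z hz =>
    tendsto_nhds_unique hz (hy k ⟨z, hz⟩)
  let S := {i : ι // fin (some (some i)) ∧ y (some (some i)) ≠ 0}
  let O : Finset (Option (Option ι)) := {k | fin k ∧ y k = 0}
  obtain ⟨i₀, z₀, hz₀, hi₀⟩ := hS
  have : Nonempty S := ⟨⟨i₀, ⟨z₀, hi₀⟩, by rwa [← huniq (some (some i₀)) z₀ hi₀]⟩⟩
  have hne : ∀ (j : S) k, k ≠ some (some j.1) → fin k → y k ≠ y (some (some j.1)) := by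
    intro j k hk hf he
    exact j.2.2 (hinj j.1 k _ hk (hy _ j.2.1) (he ▸ hy _ hf))
  have hB : 0 < ∑ k ∈ O, τ k := by
    obtain ⟨k, hk, hk0⟩ := hO
    refine Finset.sum_pos' (fun k _ => hτ0 k) ⟨k, ?_, ?_⟩
    · simp [O, fin, ← huniq k 0 hk0]; exact ⟨0, hk0⟩
    · rcases k with _ | _ | i
      · simp only [hτ, Option.elim'_none]; linarith
      · exact hk rfl
      · exact Nat.cast_pos.2 (hd i)
  refine not_forall_expCoeff_eq_zero (S := S) (s := fun j => y (some (some j.1)))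
    (fun i j hij => ?_) (fun j => j.2.2) (d := fun j => d j.1) (fun j => hd _) hB fun j => ?_
  · by_contra hne'
    exact hne j (some (some i.1)) (fun h => hne' (Subtype.ext (by simpa using h))) i.2.1 hij
  have hterm : ∀ l k, Tendsto
      (fun a => wts m d (γ a) k * ((p a k - p a (some (some j.1)))⁻¹) ^ (l + 1)) 𝒰
      (𝓝 ((if k ∈ O then (τ k : ℂ) * ((0 - y (some (some j.1)))⁻¹) ^ (l + 1) else 0)
        + Option.elim' 0 (Option.elim' 0 fun i => if fin (some (some i)) ∧ y (some (some i)) ≠ 0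
          then (d i : ℂ) * ((y (some (some i)) - y (some (some j.1)))⁻¹) ^ (l + 1) else 0) k)) := by
    intro l k
    have hyj := hy _ j.2.1
    by_cases hkj : k = some (some j.1)
    · subst hkj
      have : some (some j.1) ∉ O := fun h => j.2.2 (Finset.mem_filter.1 h).2.2
      simp [this]
    by_cases hk : fin k
    · have hyk := hy k hk
      have hlim := (hw k).mul (((hyk.sub hyj).inv₀ (sub_ne_zero.2 (hne j k hkj hk))).pow (l + 1))
      by_cases hk0 : y k = 0
      · have hkO : k ∈ O := by simp [O, hk, hk0]
        convert hlim using 2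
        rw [if_pos hkO, hk0]
        rcases k with _ | _ | i
        · simp
        · simp
        · simp [hk0]
      · have hkO : k ∉ O := fun h => hk0 (Finset.mem_filter.1 h).2.2
        convert hlim using 2
        rw [if_neg hkO, zero_add]
        rcases k with _ | _ | i
        · exact absurd (huniq none _ (by simpa [hp, pts] using hyk) ▸
            hzero _ (by simpa [hp, pts] using hyk)) hk0
        · have := (hone _ (by simpa [hp, pts] using hyk)).resolve_left hk0
          simp [hτ, this]
        · simp [hk, hk0, hτ]
    · have hkO : k ∉ O := fun h => hk (Finset.mem_filter.1 h).2.1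
      have h1 := (hw k).mul ((tendsto_inv₀_cobounded.comp
        (tendsto_cobounded_sub (hinf k hk) hyj)).pow (l + 1))
      rw [zero_pow l.succ_ne_zero, mul_zero] at h1
      refine Tendsto.congr' (.of_forall fun _ => rfl) (h1.trans_eq (congrArg 𝓝 ?_))
      rw [if_neg hkO, zero_add]
      rcases k with _ | _ | i
      · simp
      · simp
      · simp [hk]
  have hlim := tendsto_expCoeff (L := fun a => powSum (wts m d (γ a)) (p a) (p a (some (some j.1))))
    (F := (𝒰 : Filter α)) (fun l => tendsto_finsetSum univ fun k _ => hterm l k) (d j.1 - 1)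
  have hzero' : ∀ᶠ a in 𝒰, expCoeff
      (powSum (wts m d (γ a)) (p a) (p a (some (some j.1)))) (d j.1 - 1) = 0 := by
    filter_upwards [ht] with a ha
    have := expCoeff_powSum_affine (wts m d (γ a)) (pts (t a)) (t a j.1) (c a) (δ a) (d j.1 - 1)
    rw [ha.2 j.1, mul_zero] at this
    exact this
  have h3 := tendsto_nhds_unique (hlim.congr' hzero') tendsto_const_nhds
  refine Eq.trans (congrArg (fun L => expCoeff L (d j.1 - 1)) ?_) h3
  funext l
  rw [powSum, Fintype.sum_option, Finset.sum_add_distrib]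
  refine congrArg₂ (· + ·) ?_ ?_
  · rw [Finset.sum_ite_mem, Finset.univ_inter, ← Finset.sum_mul, Option.elim'_none,
      Option.elim'_none, Complex.ofReal_sum]
  · rw [Fintype.sum_option, Fintype.sum_option]
    simp only [Option.elim'_none, Option.elim'_some, zero_add]
    rw [← Finset.sum_filter]
    refine (Finset.sum_subtype
      (p := fun i : ι => fin (some (some i)) ∧ y (some (some i)) ≠ 0) _ (fun i => ?_)
      (fun i => (d i : ℂ) * ((y (some (some i)) - y (some (some j.1)))⁻¹) ^ (l + 1))).symm
    rw [Finset.mem_filter, and_iff_right (Finset.mem_univ i)]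

end Solutions

section Properness

variable {ι : Type*} [Fintype ι] [DecidableEq ι]
variable {α : Type*} {𝒰 : Ultrafilter α} {m : ℕ} {d : ι → ℕ} {γ : α → ℝ} {γ₀ : ℝ} {t : α → ι → ℂ}

lemma not_tendsto_of_mul_eq {f g : α → ℂ} {z c : ℂ} (hc : c ≠ 0) (hf : Tendsto f 𝒰 (𝓝 z))
    (hg : Tendsto g 𝒰 (𝓝 0)) {h : α → ℂ} (hh : Tendsto h 𝒰 (𝓝 c))
    (e : ∀ᶠ a in 𝒰, f a * g a = h a) : False := by
  have h1 := hf.mul hg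
  rw [mul_zero] at h1
  exact hc (tendsto_nhds_unique hh (h1.congr' e))

lemma not_collide (hd : ∀ i, 1 ≤ d i) (hγ : Tendsto γ 𝒰 (𝓝 γ₀)) (h0 : 0 ≤ γ₀) (h2 : γ₀ < m + 2)
    (ht : ∀ᶠ a in 𝒰, t a ∈ Sol m d (γ a)) {i k : ι} (hik : i ≠ k) :
    ¬ Tendsto (fun a => (t a k - t a i) / t a i) 𝒰 (𝓝 0) := by
  intro hlim
  obtain ⟨⟨p, q⟩, hpq, hmin⟩ := exists_eventually_le 𝒰 (P := univ.offDiag)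
    ⟨(i, k), by simp [hik]⟩ (fun a x => ‖(t a x.2 - t a x.1) / t a x.1‖)
  have hpq' : p ≠ q := by simpa using hpq
  have hinj : ∀ᶠ a in 𝒰, Function.Injective (t a) ∧ ∀ i, t a i ≠ 0 :=
    ht.mono fun a ha => ⟨(injective_pts.1 ha.1).1, (injective_pts.1 ha.1).2.1⟩
  set δ : α → ℂ := fun a => t a q - t a p with hδ
  have hδ0 : ∀ᶠ a in 𝒰, δ a ≠ 0 := hinj.mono fun a ha h => hpq' (ha.1 (sub_eq_zero.1 h)).symm
  have hr : Tendsto (fun a => δ a / t a p) 𝒰 (𝓝 0) := by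
    refine squeeze_zero_norm' (hmin.mono fun a h => h (i, k) (by simp [hik])) ?_
    simpa using hlim.norm
  have hsep : ∀ i k z w, i ≠ k → Tendsto (fun a => (t a i - t a p) / δ a) 𝒰 (𝓝 z) →
      Tendsto (fun a => (t a k - t a p) / δ a) 𝒰 (𝓝 w) → z ≠ w := by
    intro i k z w hne hz hw
    have h1 := ((hz.mul hr).const_add 1).norm
    have h2 := (hw.sub hz).norm
    have h3 := le_of_tendsto_of_tendsto h1 h2 (by
      filter_upwards [hmin, hinj, hδ0] with a ha hb hc
      have h4 := ha (i, k) (by simp [hne])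
      have hp := hb.2 p
      have hi := hb.2 i
      have e1 : 1 + (t a i - t a p) / δ a * (δ a / t a p) = t a i / t a p := by
        field_simp
        ring
      have e2 : (t a k - t a p) / δ a - (t a i - t a p) / δ a = (t a k - t a i) / δ a := by
        rw [← sub_div, sub_sub_sub_cancel_right]
      simp only at h4
      rw [e1, e2]
      rw [norm_div, norm_div] at h4 ⊢
      rw [div_le_div_iff₀ (norm_pos_iff.2 hp) (norm_pos_iff.2 hi)] at h4
      rw [div_le_div_iff₀ (norm_pos_iff.2 hp) (norm_pos_iff.2 hc), mul_comm]
      exact h4)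
    rintro rfl
    norm_num at h3
  have hnone : ∀ z, ¬ Tendsto (fun a => (0 - t a p) / δ a) 𝒰 (𝓝 z) := by
    intro z hz
    refine not_tendsto_of_mul_eq (c := -1) (by norm_num) hz hr tendsto_const_nhds ?_
    filter_upwards [hinj, hδ0] with a hb hc
    have hp := hb.2 p
    field_simp
    ring
  have hup : Tendsto (fun a => (t a p - t a p) / δ a) 𝒰 (𝓝 0) := by simp
  have huq : Tendsto (fun a => (t a q - t a p) / δ a) 𝒰 (𝓝 1) :=
    tendsto_const_nhds.congr' (hδ0.mono fun a ha => (div_self ha).symm)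
  by_cases h1 : ∃ y, Tendsto (fun a => (1 - t a p) / δ a) 𝒰 (𝓝 y) ∧
      (0 < γ₀ ∨ ∃ i, Tendsto (fun a => (t a i - t a p) / δ a) 𝒰 (𝓝 y))
  · obtain ⟨y, hy, hy'⟩ := h1
    have hshift : ∀ (f : α → ℂ) z, Tendsto (fun a => (f a - 1) / δ a) 𝒰 (𝓝 z) →
        Tendsto (fun a => (f a - t a p) / δ a) 𝒰 (𝓝 (z + y)) := fun f z hz => by
      refine (hz.add hy).congr fun a => ?_
      rw [← add_div, sub_add_sub_cancel]
    have hshift' : ∀ (f : α → ℂ) z, Tendsto (fun a => (f a - t a p) / δ a) 𝒰 (𝓝 z) →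
        Tendsto (fun a => (f a - 1) / δ a) 𝒰 (𝓝 (z - y)) := fun f z hz => by
      refine (hz.sub hy).congr fun a => ?_
      rw [← sub_div, sub_sub_sub_cancel_right]
    refine no_bubble hd hγ h0 h2 ht (fun _ => 1) δ ?_ ?_ ?_ ?_ ?_
    · rintro i (_ | _ | k) z hk hz hz'
      · exact absurd (hshift (fun _ => 0) z hz') (hnone _)
      · exact tendsto_nhds_unique hz' (by simp [pts])
      · exact absurd rfl (hsep i k _ _ (fun h => hk (by rw [h])) (hshift _ z hz)
          (hshift (fun a => t a k) z hz'))
    · exact fun z hz => absurd (hshift (fun _ => 0) z hz) (hnone _)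
    · exact fun z hz => .inl (tendsto_nhds_unique hz (by simp))
    · rcases eq_or_ne y 0 with rfl | hy0
      · exact ⟨q, _, by simp, hshift' _ _ huq⟩
      · exact ⟨p, _, by simpa using hy0, hshift' _ _ hup⟩
    · rcases hy' with hy' | ⟨i, hi⟩
      · exact ⟨some none, fun _ => hy', by simp [pts]⟩
      · exact ⟨some (some i), by simp, by simpa [pts] using hshift' _ _ hi⟩
  · push Not at h1
    refine no_bubble hd hγ h0 h2 ht (fun a => t a p) δ ?_ ?_ ?_ ?_ ?_
    · rintro i (_ | _ | k) z hk hz hz'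
      · exact absurd hz' (hnone _)
      · exact absurd hz ((h1 z hz').2 i)
      · exact absurd rfl (hsep i k _ _ (fun h => hk (by rw [h])) hz hz')
    · exact fun z hz => absurd hz (hnone _)
    · exact fun z hz => .inr (le_antisymm (h1 z hz).1 h0)
    · exact ⟨q, 1, one_ne_zero, huq⟩
    · exact ⟨some (some p), by simp, hup⟩

lemma eq_zero_of_common_limit (hd : ∀ i, 1 ≤ d i) (hγ : Tendsto γ 𝒰 (𝓝 γ₀)) (h0 : 0 ≤ γ₀)
    (h2 : γ₀ < m + 2) (ht : ∀ᶠ a in 𝒰, t a ∈ Sol m d (γ a)) {δ : α → ℂ}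
    (hδ : ∀ᶠ a in 𝒰, δ a ≠ 0) {i k : ι} (hik : i ≠ k) {z : ℂ}
    (hi : Tendsto (fun a => (t a i - 0) / δ a) 𝒰 (𝓝 z))
    (hk : Tendsto (fun a => (t a k - 0) / δ a) 𝒰 (𝓝 z)) : z = 0 := by
  by_contra hz
  have := (hk.sub hi).div hi hz
  rw [sub_self, zero_div] at this
  refine not_collide hd hγ h0 h2 ht hik (this.congr' ?_)
  filter_upwards [hδ] with a ha
  simp only [Pi.div_apply, sub_zero]
  rw [← sub_div, div_div_div_cancel_right₀ ha]

/-- Configurations without residues can only degenerate by one of the `tᵢ` tending to `1`, and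
only if the order at `1` tends to zero. -/
lemma exists_tendsto_of_mem_Sol (hd : ∀ i, 1 ≤ d i) (hγ : Tendsto γ 𝒰 (𝓝 γ₀)) (h0 : 0 ≤ γ₀)
    (h2 : γ₀ < m + 2) (ht : ∀ᶠ a in 𝒰, t a ∈ Sol m d (γ a)) :
    ∃ t₀ : ι → ℂ, Tendsto t 𝒰 (𝓝 t₀) ∧ Function.Injective t₀ ∧ (∀ i, t₀ i ≠ 0) ∧
      (0 < γ₀ → ∀ i, t₀ i ≠ 1) := by
  have hne : ∀ᶠ a in 𝒰, ∀ i, t a i ≠ 0 := ht.mono fun a ha => (injective_pts.1 ha.1).2.1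
  have hB : ∀ i, ¬ Tendsto (fun a => t a i) 𝒰 (Bornology.cobounded ℂ) := by
    intro i hi
    obtain ⟨p, -, hp⟩ := exists_eventually_le 𝒰 (P := univ) ⟨i, Finset.mem_univ i⟩
      (fun a k => -‖t a k‖)
    have hp' : Tendsto (fun a => t a p) 𝒰 (Bornology.cobounded ℂ) :=
      tendsto_norm_atTop_iff_cobounded.1 (tendsto_atTop_mono'  _
        (hp.mono fun a ha => neg_le_neg_iff.1 (ha i (Finset.mem_univ i)))
        (tendsto_norm_atTop_iff_cobounded.2 hi))
    have hone : Tendsto (fun a => (1 - 0) / t a p) 𝒰 (𝓝 0) := by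
      simpa [Function.comp_def] using tendsto_inv₀_cobounded.comp hp'
    refine no_bubble hd hγ h0 h2 ht (fun _ => 0) (fun a => t a p) ?_ ?_ ?_ ?_ ?_
    · rintro i (_ | _ | k) z hk hz hz'
      · exact tendsto_nhds_unique hz' (by simp [pts])
      · exact tendsto_nhds_unique hz' hone
      · exact eq_zero_of_common_limit hd hγ h0 h2 ht (hne.mono fun a ha => ha p)
          (fun h => hk (by rw [h])) hz hz'
    · exact fun z hz => tendsto_nhds_unique hz (by simp)
    · exact fun z hz => .inl (tendsto_nhds_unique hz hone)
    · refine ⟨p, 1, one_ne_zero, tendsto_const_nhds.congr' (hne.mono fun a ha => ?_)⟩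
      simp only [sub_zero, div_self (ha p)]
    · exact ⟨none, by simp, by simp [pts]⟩
  have hlim : ∀ i, ∃ z, Tendsto (fun a => t a i) 𝒰 (𝓝 z) := fun i =>
    (exists_tendsto_or_cobounded 𝒰 _).resolve_right (hB i)
  choose t₀ ht₀ using hlim
  have ht₀0 : ∀ i, t₀ i ≠ 0 := by
    intro i hi0
    obtain ⟨p, -, hp⟩ := exists_eventually_le 𝒰 (P := univ) ⟨i, Finset.mem_univ i⟩
      (fun a k => ‖t a k‖)
    have hp' : Tendsto (fun a => t a p) 𝒰 (𝓝 0) := by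
      refine squeeze_zero_norm' (hp.mono fun a ha => ha i (Finset.mem_univ i)) ?_
      simpa [hi0] using (ht₀ i).norm
    have hone : ∀ z, ¬ Tendsto (fun a => (1 - 0) / t a p) 𝒰 (𝓝 z) := fun z hz =>
      not_tendsto_of_mul_eq one_ne_zero hz hp' tendsto_const_nhds (hne.mono fun a ha => by
        rw [sub_zero, div_mul_cancel₀ _ (ha p)])
    refine no_bubble hd hγ h0 h2 ht (fun _ => 0) (fun a => t a p) ?_ ?_ ?_ ?_ ?_
    · rintro i (_ | _ | k) z hk hz hz'
      · exact tendsto_nhds_unique hz' (by simp [pts])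
      · exact absurd hz' (hone z)
      · exact eq_zero_of_common_limit hd hγ h0 h2 ht (hne.mono fun a ha => ha p)
          (fun h => hk (by rw [h])) hz hz'
    · exact fun z hz => tendsto_nhds_unique hz (by simp)
    · exact fun z hz => absurd hz (hone z)
    · refine ⟨p, 1, one_ne_zero, tendsto_const_nhds.congr' (hne.mono fun a ha => ?_)⟩
      simp only [sub_zero, div_self (ha p)]
    · exact ⟨none, by simp, by simp [pts]⟩
  have hinj₀ : Function.Injective t₀ := by
    intro i k hik
    by_contra hne'
    refine ht₀0 i (eq_zero_of_common_limit hd hγ h0 h2 ht (δ := fun _ => 1) (by simp) hne' ?_ ?_)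
    · simpa using ht₀ i
    · simpa [hik] using ht₀ k
  refine ⟨t₀, tendsto_pi_nhds.2 ht₀, hinj₀, ht₀0, fun hpos j hj => ?_⟩
  have hδ : Tendsto (fun a => t a j - 1) 𝒰 (𝓝 0) := by
    simpa [hj] using (ht₀ j).sub_const 1
  have hδ0 : ∀ᶠ a in 𝒰, t a j - 1 ≠ 0 :=
    ht.mono fun a ha => sub_ne_zero.2 ((injective_pts.1 ha.1).2.2 j)
  have hinf : ∀ (f : α → ℂ) c z, c ≠ 1 → Tendsto f 𝒰 (𝓝 c) →
      ¬ Tendsto (fun a => (f a - 1) / (t a j - 1)) 𝒰 (𝓝 z) := fun f c z hc hf hz =>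
    not_tendsto_of_mul_eq (sub_ne_zero.2 hc) hz hδ (hf.sub_const 1)
      (hδ0.mono fun a ha => div_mul_cancel₀ _ ha)
  refine no_bubble hd hγ h0 h2 ht (fun _ => 1) (fun a => t a j - 1) ?_ ?_ ?_ ?_ ?_
  · rintro i (_ | _ | k) z hk hz hz'
    · exact absurd hz' (hinf _ 0 z zero_ne_one tendsto_const_nhds)
    · exact tendsto_nhds_unique hz' (by simp [pts])
    · rcases eq_or_ne k j with rfl | hkj
      · have hik : i ≠ k := fun h => hk (by rw [h])
        exact absurd hz (hinf _ _ z (fun h => hik (hinj₀ (h.trans hj.symm))) (ht₀ i))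
      · exact absurd hz' (hinf _ _ z (fun h => hkj (hinj₀ (h.trans hj.symm))) (ht₀ k))
  · exact fun z hz => absurd hz (hinf _ 0 z zero_ne_one tendsto_const_nhds)
  · exact fun z hz => .inl (tendsto_nhds_unique hz (by simp))
  · exact ⟨j, 1, one_ne_zero, tendsto_const_nhds.congr' (hδ0.mono fun a ha => (div_self ha).symm)⟩
  · exact ⟨some none, fun _ => hpos, by simp [pts]⟩

end Properness

lemma exists_implicit_section {E : Type*} [NormedAddCommGroup E] [NormedSpace ℂ E]
    [FiniteDimensional ℂ E] {F : ℂ × E → E} {p₀ : ℂ} {x₀ : E} (hF : ContDiffAt ℂ 1 F (p₀, x₀))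
    (h0 : F (p₀, x₀) = 0)
    (hinj : ∀ v, HasDerivAt (fun η : ℂ => F (p₀, x₀ + η • v)) 0 0 → v = 0) :
    ∃ ψ : ℂ → E, Tendsto ψ (𝓝 p₀) (𝓝 x₀) ∧ (∀ᶠ p in 𝓝 p₀, F (p, ψ p) = 0) ∧
      ∀ᶠ v in 𝓝 (p₀, x₀), F v = 0 → v.2 = ψ v.1 := by
  have : CompleteSpace E := FiniteDimensional.complete ℂ E
  have hs := hF.hasStrictFDerivAt one_ne_zero
  set f' := fderiv ℂ F (p₀, x₀)
  have hinj' : Function.Injective (f' ∘L .inr ℂ ℂ E) := by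
    rw [injective_iff_map_eq_zero]
    intro v hv
    refine hinj v ?_
    have h1 : HasDerivAt (fun η : ℂ => (p₀, x₀ + η • v)) ((0, v) : ℂ × E) 0 := by
      refine (hasDerivAt_const _ _).prodMk ?_
      simpa using (((hasDerivAt_id (0 : ℂ)).smul_const v).const_add x₀)
    have h2 := hs.hasFDerivAt
    have h3 : HasFDerivAt F f' ((fun η : ℂ => (p₀, x₀ + η • v)) 0) := by simpa using h2
    have := h3.comp_hasDerivAt (0 : ℂ) h1
    have h4 : f' (0, v) = 0 := by simpa using hv
    rw [h4] at this
    exact this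
  have hinv : (f' ∘L .inr ℂ ℂ E).IsInvertible :=
    ⟨(LinearEquiv.ofInjectiveEndo (f' ∘L .inr ℂ ℂ E).toLinearMap hinj').toContinuousLinearEquiv,
      by ext; rfl⟩
  refine ⟨hs.implicitFunctionOfProdDomain hinv, hs.tendsto_implicitFunctionOfProdDomain hinv, ?_, ?_⟩
  · simpa [h0] using hs.eventually_apply_implicitFunctionOfProdDomain hinv
  · filter_upwards [hs.eventually_apply_eq_iff_implicitFunctionOfProdDomain hinv] with v hv h
    exact (hv.1 (by rw [h, h0])).symm

lemma eventually_ncard_eq {P X L : Type*} [Finite L] {l : Filter P} {S : P → Set X}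
    (s : L → P → X) (hs : ∀ i, ∀ᶠ p in l, s i p ∈ S p)
    (hne : ∀ i j, i ≠ j → ∀ᶠ p in l, s i p ≠ s j p)
    (hsurj : ∀ (𝒰 : Ultrafilter P) (x : P → X), (𝒰 : Filter P) ≤ l → (∀ᶠ p in 𝒰, x p ∈ S p) →
      ∃ i, ∀ᶠ p in 𝒰, x p = s i p) :
    ∀ᶠ p in l, (S p).Finite ∧ (S p).ncard = Nat.card L := by
  have hs' : ∀ᶠ p in l, ∀ i, s i p ∈ S p := eventually_all.2 hs
  have hne' : ∀ᶠ p in l, ∀ i j, i ≠ j → s i p ≠ s j p :=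
    eventually_all.2 fun i => eventually_all.2 fun j => by
      by_cases h : i = j
      · simp [h]
      · simpa [h] using hne i j h
  have hsurj' : ∀ᶠ p in l, ∀ x ∈ S p, ∃ i, x = s i p := by
    refine mem_iff_ultrafilter.2 fun 𝒰 hle => by_contra fun hcon => ?_
    have h𝒰 : ∀ᶠ p in (𝒰 : Filter P), ∃ x ∈ S p, ∀ i, x ≠ s i p := by
      refine (Ultrafilter.eventually_not.2 hcon).mono fun p hp => ?_
      push Not at hp
      exact hp
    have : Nonempty X := let ⟨_, x, _⟩ := h𝒰.exists; ⟨x⟩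
    choose! x hx using fun p (hp : ∃ x ∈ S p, ∀ i, x ≠ s i p) => hp
    obtain ⟨i, hi⟩ := hsurj 𝒰 x hle (h𝒰.mono fun p hp => (hx p hp).1)
    obtain ⟨p, h1, h2⟩ := (hi.and h𝒰).exists
    exact (hx p h2).2 i h1
  filter_upwards [hs', hne', hsurj'] with p h1 h2 h3
  have : S p = Set.range fun i => s i p := by
    ext x
    exact ⟨fun hx => (h3 x hx).imp fun i hi => hi.symm, by rintro ⟨i, rfl⟩; exact h1 i⟩
  rw [this]
  refine ⟨Set.finite_range _, ?_⟩
  rw [← Set.image_univ, Set.ncard_image_of_injective _ fun i j h => by_contra fun h' => h2 i j h' h,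
    Set.ncard_univ]

section Regularity

variable {κ : Type*} [Fintype κ]

lemma tendsto_powSum {α : Type*} {F : Filter α} {σ q : α → κ → ℂ} {σ₀ q₀ : κ → ℂ}
    (hσ : ∀ i, Tendsto (fun a => σ a i) F (𝓝 (σ₀ i)))
    (hq : ∀ i, Tendsto (fun a => q a i) F (𝓝 (q₀ i))) {j : κ} (hj : ∀ i ≠ j, q₀ i ≠ q₀ j) (l : ℕ) :
    Tendsto (fun a => powSum (σ a) (q a) (q a j) l) F (𝓝 (powSum σ₀ q₀ (q₀ j) l)) := by
  refine tendsto_finsetSum _ fun i _ => ?_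
  by_cases hij : i = j
  · subst hij
    simp only [sub_self, inv_zero, zero_pow (Nat.succ_ne_zero _), mul_zero]
    exact tendsto_const_nhds
  · exact (hσ i).mul ((((hq i).sub (hq j)).inv₀ (sub_ne_zero.2 (hj i hij))).pow _)

lemma contDiffAt_powSum {E : Type*} [NormedAddCommGroup E] [NormedSpace ℂ E] {σ q : E → κ → ℂ}
    {x : E} {n : WithTop ℕ∞} (hσ : ∀ i, ContDiffAt ℂ n (fun a => σ a i) x)
    (hq : ∀ i, ContDiffAt ℂ n (fun a => q a i) x) {j : κ} (hj : ∀ i ≠ j, q x i ≠ q x j) (l : ℕ) :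
    ContDiffAt ℂ n (fun a => powSum (σ a) (q a) (q a j) l) x := by
  refine ContDiffAt.sum fun i _ => ?_
  by_cases hij : i = j
  · subst hij
    simp only [sub_self, inv_zero, zero_pow (Nat.succ_ne_zero _), mul_zero]
    exact contDiffAt_const
  · exact (hσ i).mul ((((hq i).sub (hq j)).inv (sub_ne_zero.2 (hj i hij))).pow _)

end Regularity

section Interior

variable {ι : Type*} [Fintype ι] [DecidableEq ι] {m : ℕ} {d : ι → ℕ}

lemma sum_wts (m : ℕ) (d : ι → ℕ) (γ : ℂ) :
    ∑ i, wts m d γ i = m + 2 + ∑ j ∈ univ.map (Function.Embedding.some.trans Function.Embedding.some),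
      ((Option.elim' 0 (Option.elim' 0 d) j : ℕ) : ℂ) := by
  simp [wts, Fintype.sum_option]
  ring

lemma eq_zero_of_hasDerivAt (hd : ∀ i, 1 ≤ d i) {γ : ℂ} {t v : ι → ℂ} (ht : t ∈ Sol m d γ)
    (hv : ∀ j, HasDerivAt (fun η : ℂ =>
      expCoeff (powSum (wts m d γ) (pts (t + η • v)) ((t + η • v) j)) (d j - 1)) 0 0) : v = 0 := by
  set V : Option (Option ι) → ℂ := Option.elim' 0 (Option.elim' 0 v) with hV
  set J : Finset (Option (Option ι)) :=
    univ.map (Function.Embedding.some.trans Function.Embedding.some)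
  have key : V = 0 := by
    refine eq_zero_of_variation (J := J) (d := Option.elim' 0 (Option.elim' 0 d)) ht.1 (σ := wts m d γ)
      (m := m) ?_ ?_ ?_ ?_ ?_ ?_ ?_
    · simp [J, hd]
    · simp [J, wts]
    · simp [J]
    · exact sum_wts m d γ
    · simpa [J, pts] using ht.2
    · rintro (_ | _ | i) hi
      · rfl
      · rfl
      · simp [J] at hi
    · simp only [J, Finset.mem_map, Finset.mem_univ, true_and, Function.Embedding.trans_apply,
        Function.Embedding.some_apply, forall_exists_index, forall_apply_eq_imp_iff]
      intro j
      have h0 : pts (t + (0 : ℂ) • v) = pts t := by simp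
      have := hasDerivAt_expCoeff_powSum (wts m d γ) (q := fun η : ℂ => pts (t + η • v)) (v := V)
        (η := 0) (by rw [h0]; exact ht.1) (by
          rintro (_ | _ | i)
          · exact hasDerivAt_const _ _
          · exact hasDerivAt_const _ _
          · simpa [pts, hV] using
              ((hasDerivAt_id (0 : ℂ)).mul_const (v i)).const_add (t i)) (some (some j)) (d j - 1)
        (by rw [h0]; exact ht.2 j)
      rw [h0] at this
      exact this.unique (hv j)
  funext i
  simpa [hV] using congrFun key (some (some i))

lemma contDiffAt_pts {t : ι → ℂ} {p : ℂ} {n : WithTop ℕ∞} (i) :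
    ContDiffAt ℂ n (fun v : ℂ × (ι → ℂ) => pts v.2 i) (p, t) := by
  rcases i with _ | _ | i
  · exact contDiffAt_const
  · exact contDiffAt_const
  · exact (contDiff_pi.1 contDiff_snd i).contDiffAt

lemma contDiffAt_wts {t : ι → ℂ} {p : ℂ} {n : WithTop ℕ∞} (i) :
    ContDiffAt ℂ n (fun v : ℂ × (ι → ℂ) => wts m d v.1 i) (p, t) := by
  rcases i with _ | _ | i
  · exact contDiffAt_const.sub contDiffAt_fst
  · exact contDiffAt_fst
  · exact contDiffAt_const

lemma exists_section_Sol (hd : ∀ i, 1 ≤ d i) {γ₀ : ℝ} {t₀ : ι → ℂ} (ht : t₀ ∈ Sol m d γ₀) :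
    ∃ ψ : ℝ → ι → ℂ, Tendsto ψ (𝓝 γ₀) (𝓝 t₀) ∧ (∀ᶠ γ : ℝ in 𝓝 γ₀, ψ γ ∈ Sol m d γ) ∧
      ∀ᶠ v in 𝓝 (γ₀, t₀), v.2 ∈ Sol m d (v.1 : ℝ) → v.2 = ψ v.1 := by
  obtain ⟨ψ, h1, h2, h3⟩ := exists_implicit_section (p₀ := (γ₀ : ℂ)) (x₀ := t₀)
    (F := fun v j => expCoeff (powSum (wts m d v.1) (pts v.2) (v.2 j)) (d j - 1))
    (contDiffAt_pi.2 fun j => contDiffAt_expCoeff (fun l => contDiffAt_powSum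
      (fun i => contDiffAt_wts i) (fun i => contDiffAt_pts i) (j := some (some j))
      (fun i hi => ht.1.ne hi) l) _) (funext ht.2)
    (fun v hv => eq_zero_of_hasDerivAt hd ht (hasDerivAt_pi.1 hv))
  have hc : Tendsto (fun γ : ℝ => (γ : ℂ)) (𝓝 γ₀) (𝓝 γ₀) := Complex.continuous_ofReal.tendsto γ₀
  refine ⟨fun γ => ψ γ, h1.comp hc, ?_, ?_⟩
  · have hinj : ∀ᶠ t in 𝓝 t₀, Function.Injective (pts t) := by
      have : ∀ᶠ t in 𝓝 t₀, ∀ i j, i ≠ j → pts t i ≠ pts t j := by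
        refine eventually_all.2 fun i => eventually_all.2 fun j => ?_
        by_cases hij : i = j
        · simp [hij]
        have hcont : ∀ k, ContinuousAt (fun t : ι → ℂ => pts t k) t₀ := by
          rintro (_ | _ | k)
          · exact continuousAt_const
          · exact continuousAt_const
          · exact (continuous_apply k).continuousAt
        filter_upwards [((hcont i).sub (hcont j)).eventually_ne (sub_ne_zero.2 (ht.1.ne hij))]
          with t h _ using sub_ne_zero.1 h
      exact this.mono fun t h i j hij => by_contra fun h' => h i j h' hij
    filter_upwards [hc.eventually h2, (h1.comp hc).eventually hinj] with γ h h'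
    exact ⟨h', fun j => congrFun h j⟩
  · have hc' : Tendsto (fun v : ℝ × (ι → ℂ) => ((v.1 : ℂ), v.2)) (𝓝 (γ₀, t₀)) (𝓝 ((γ₀ : ℂ), t₀)) :=
      ((Complex.continuous_ofReal.comp continuous_fst).prodMk continuous_snd).tendsto _
    exact (hc'.eventually h3).mono fun v h hv => h (funext hv.2)

lemma tendsto_wts {α : Type*} {F : Filter α} {γ : α → ℝ} {γ₀ : ℝ} (hγ : Tendsto γ F (𝓝 γ₀)) (i) :
    Tendsto (fun a => wts m d (γ a) i) F (𝓝 (wts m d γ₀ i)) := by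
  have hc := (Complex.continuous_ofReal.tendsto γ₀).comp hγ
  rcases i with _ | _ | i
  · exact tendsto_const_nhds.sub hc
  · exact hc
  · exact tendsto_const_nhds

lemma exists_tendsto_mem_Sol (hd : ∀ i, 1 ≤ d i) {α : Type*} {𝒰 : Ultrafilter α} {γ : α → ℝ}
    {γ₀ : ℝ} {t : α → ι → ℂ} (hγ : Tendsto γ 𝒰 (𝓝 γ₀)) (h0 : 0 < γ₀)
    (h2 : γ₀ < m + 2) (ht : ∀ᶠ a in 𝒰, t a ∈ Sol m d (γ a)) :
    ∃ t₀ ∈ Sol m d γ₀, Tendsto t 𝒰 (𝓝 t₀) := by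
  obtain ⟨t₀, h, hi, hz, ho⟩ := exists_tendsto_of_mem_Sol hd hγ h0.le h2 ht
  have hinj := injective_pts.2 ⟨hi, hz, ho h0⟩
  refine ⟨t₀, ⟨hinj, fun j => ?_⟩, h⟩
  have hlim := tendsto_expCoeff (F := (𝒰 : Filter α)) (tendsto_powSum (σ := fun a => wts m d (γ a))
    (q := fun a => pts (t a)) (q₀ := pts t₀) (tendsto_wts hγ) (by
      rintro (_ | _ | i)
      · exact tendsto_const_nhds
      · exact tendsto_const_nhds
      · exact tendsto_pi_nhds.1 h i) (j := some (some j)) (fun i hi => hinj.ne hi)) (d j - 1)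
  refine tendsto_nhds_unique (hlim.congr' ?_) tendsto_const_nhds
  exact ht.mono fun a ha => ha.2 j

lemma finite_Sol (hd : ∀ i, 1 ≤ d i) {γ₀ : ℝ} (h0 : 0 < γ₀) (h2 : γ₀ < m + 2) :
    (Sol m d γ₀).Finite := by
  by_contra hinf
  have : Infinite (Sol m d γ₀) := Set.infinite_coe_iff.2 hinf
  obtain ⟨t₀, ht₀, hlim⟩ := exists_tendsto_mem_Sol hd (𝒰 := hyperfilter (Sol m d γ₀))
    (γ := fun _ => γ₀) (t := Subtype.val) tendsto_const_nhds h0 h2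
    (Eventually.of_forall fun a => a.2)
  obtain ⟨ψ, -, -, h3⟩ := exists_section_Sol hd ht₀
  have := ((tendsto_const_nhds (x := γ₀)).prodMk_nhds hlim).eventually h3
  have hfin : {a : Sol m d γ₀ | (a : ι → ℂ) = ψ γ₀}.Finite :=
    Set.Subsingleton.finite fun a ha b hb => Subtype.ext (ha.trans hb.symm)
  refine hfin.notMem_hyperfilter ?_
  exact this.mono fun a ha => ha a.2

lemma eventually_ncard_Sol (hd : ∀ i, 1 ≤ d i) {γ₀ : ℝ} (h0 : 0 < γ₀) (h2 : γ₀ < m + 2) :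
    ∀ᶠ γ : ℝ in 𝓝 γ₀, (Sol m d γ).ncard = (Sol m d γ₀).ncard := by
  have : Finite (Sol m d γ₀) := finite_Sol hd h0 h2
  choose ψ h1 h2' h3 using fun t : Sol m d γ₀ => exists_section_Sol hd t.2
  have := eventually_ncard_eq (S := fun γ : ℝ => Sol m d γ) (l := 𝓝 γ₀) ψ h2' (fun i j hij => by
      filter_upwards [((h1 i).sub (h1 j)).eventually_ne
        (sub_ne_zero.2 (Subtype.coe_injective.ne hij))] with γ h using sub_ne_zero.1 h)
    (fun 𝒰 x hle hx => by
      obtain ⟨t₀, ht₀, hlim⟩ := exists_tendsto_mem_Sol hd (γ := id) hle h0 h2 hx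
      refine ⟨⟨t₀, ht₀⟩, ?_⟩
      have hid : Tendsto (fun γ : ℝ => γ) 𝒰 (𝓝 γ₀) := hle
      filter_upwards [(hid.prodMk_nhds hlim).eventually (h3 ⟨t₀, ht₀⟩), hx] with γ h h' using h h')
  exact this.mono fun γ h => h.2

lemma ncard_Sol_eq (hd : ∀ i, 1 ≤ d i) {γ γ' : ℝ} (hγ : γ ∈ Set.Ioo (0 : ℝ) (m + 2))
    (hγ' : γ' ∈ Set.Ioo (0 : ℝ) (m + 2)) : (Sol m d γ).ncard = (Sol m d γ').ncard := by
  refine isPreconnected_Ioo.constant_of_mapsTo (S := Set.Ioo (0 : ℝ) (m + 2)) (T := Set.univ)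
    (f := fun γ : ℝ => (Sol m d γ).ncard) ⟨inferInstance⟩ (fun x hx => ?_) (fun _ _ => Set.mem_univ _) hγ hγ'
  refine ContinuousAt.continuousWithinAt ?_
  refine (tendsto_pure.2 ?_).mono_right (pure_le_nhds _)
  exact eventually_ncard_Sol hd hx.1 hx.2

end Interior

section Factor

/-- The coefficients of `((1 - x)^(-γ) - 1) / γ`. -/
noncomputable def binomQuot (γ : ℂ) (k : ℕ) : ℂ :=
  (∑ i ∈ range (k + 1), expCoeff (fun _ => γ) i) / (k + 1)

lemma expCoeff_const_succ (γ : ℂ) (k : ℕ) :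
    expCoeff (fun _ => γ) (k + 1) = γ * binomQuot γ k := by
  rw [expCoeff_succ, binomQuot, ← Finset.sum_mul]
  ring

lemma binomQuot_zero (k : ℕ) : binomQuot 0 k = 1 / (k + 1) := by
  rw [binomQuot, Finset.sum_range_succ']
  simp [expCoeff_const_succ]

variable {ι : Type*} [Fintype ι] [DecidableEq ι] {m : ℕ} {d : ι → ℕ} {γ : ℂ} {t : ι → ℂ}

/-- The marked points `0` and `tᵢ`. -/
def base (t : ι → ℂ) : Option ι → ℂ := Option.elim' 0 t

/-- The orders of the poles at `0` and the `tᵢ`. -/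
def baseWts (m : ℕ) (d : ι → ℕ) (γ : ℂ) : Option ι → ℂ :=
  Option.elim' (m + 2 - γ) fun i => (d i : ℂ)

/-- The local expansion at `z`, ignoring the marked point `1`. -/
noncomputable def rest (m : ℕ) (d : ι → ℕ) (γ : ℂ) (t : ι → ℂ) (z : ℂ) : ℕ → ℂ :=
  expCoeff (powSum (baseWts m d γ) (base t) z)

lemma powSum_pts (z : ℂ) (l : ℕ) : powSum (wts m d γ) (pts t) z l
    = ((1 - z)⁻¹) ^ (l + 1) * γ + powSum (baseWts m d γ) (base t) z l := by
  simp only [powSum, wts, pts, baseWts, base, Fintype.sum_option, Option.elim'_none,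
    Option.elim'_some]
  ring

lemma expCoeff_powSum_pts_zero (z : ℂ) (k : ℕ) :
    expCoeff (powSum (wts m d 0) (pts t) z) k = rest m d 0 t z k := by
  rw [rest]
  congr 1
  funext l
  rw [powSum_pts, mul_zero, zero_add]

lemma expCoeff_powSum_pts (z : ℂ) (e : ℕ) : expCoeff (powSum (wts m d γ) (pts t) z) e
    = rest m d γ t z e + ∑ k ∈ range e, ((1 - z)⁻¹) ^ (k + 1) * (γ * binomQuot γ k)
      * rest m d γ t z (e - (k + 1)) := by
  rw [show powSum (wts m d γ) (pts t) z = fun l => ((1 - z)⁻¹) ^ (l + 1) * γ +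
    powSum (baseWts m d γ) (base t) z l from funext (powSum_pts z), expCoeff_add,
    Finset.sum_range_succ', add_comm]
  simp only [expCoeff_homogeneous (fun _ => γ), expCoeff_const_succ]
  simp [rest]

/-- The residue at `z = 1 - ε u`, normalised: `γ = ε ^ e`. -/
noncomputable def scaledRes (m : ℕ) (d : ι → ℕ) (γ u z : ℂ) (t : ι → ℂ) (e : ℕ) : ℂ :=
  u ^ e * rest m d γ t z e + ∑ k ∈ range e, (1 - z) ^ (e - (k + 1)) * binomQuot γ k
    * rest m d γ t z (e - (k + 1))

lemma mul_expCoeff_eq_mul_scaledRes {ε u z : ℂ} {e : ℕ} (hz : 1 - z = ε * u) (hz0 : 1 - z ≠ 0)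
    (hγ : γ = ε ^ e) : (1 - z) ^ e * expCoeff (powSum (wts m d γ) (pts t) z) e
      = γ * scaledRes m d γ u z t e := by
  rw [expCoeff_powSum_pts, scaledRes, mul_add, mul_add, Finset.mul_sum, Finset.mul_sum]
  congr 1
  · rw [hz, hγ]
    ring
  · refine Finset.sum_congr rfl fun k hk => ?_
    have : (1 - z) ^ e = (1 - z) ^ (e - (k + 1)) * (1 - z) ^ (k + 1) := by
      rw [← pow_add, Nat.sub_add_cancel (Finset.mem_range.1 hk)]
    have h2 : (1 - z) ^ (k + 1) * ((1 - z)⁻¹) ^ (k + 1) = 1 := by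
      rw [← mul_pow, mul_inv_cancel₀ hz0, one_pow]
    rw [this]
    linear_combination (1 - z) ^ (e - (k + 1)) * (γ * binomQuot γ k) *
      rest m d γ t z (e - (k + 1)) * h2

lemma scaledRes_one (u : ℂ) {e : ℕ} (he : 1 ≤ e) :
    scaledRes m d 0 u 1 t e = u ^ e * rest m d 0 t 1 e + 1 / e := by
  obtain ⟨e, rfl⟩ := Nat.exists_eq_add_of_le' he
  rw [scaledRes, Finset.sum_range_succ, Finset.sum_eq_zero, zero_add]
  · simp [binomQuot_zero, rest]
  · intro k hk
    have : e + 1 - (k + 1) ≠ 0 := by have := Finset.mem_range.1 hk; omega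
    rw [sub_self, zero_pow this, zero_mul, zero_mul]

end Factor

section Chart

variable {ι : Type*} [Fintype ι] [DecidableEq ι] {m : ℕ} {d : ι → ℕ} {p : ι}

/-- Limiting configurations as the order at `1` tends to zero and `tₚ` tends to `1`. -/
def LimSol (m : ℕ) (d : ι → ℕ) (p : ι) : Set (ι → ℂ) :=
  {t | t p = 1 ∧ Function.Injective t ∧ (∀ i, t i ≠ 0) ∧
    ∀ i ≠ p, rest m d 0 t (t i) (d i - 1) = 0}

lemma injective_base {t : ι → ℂ} (ht : Function.Injective t) (h0 : ∀ i, t i ≠ 0) :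
    Function.Injective (base t) := by
  rintro (_ | i) (_ | j) hij
  · rfl
  · exact absurd hij.symm (h0 j)
  · exact absurd hij (h0 i)
  · rw [ht hij]

lemma not_forall_rest_eq_zero [Nonempty ι] (hd : ∀ i, 1 ≤ d i) {t : ι → ℂ}
    (ht : Function.Injective t) (h0 : ∀ i, t i ≠ 0) :
    ¬ ∀ i, rest m d 0 t (t i) (d i - 1) = 0 := by
  intro h
  refine not_forall_expCoeff_eq_zero ht h0 hd (B := m + 2) (by positivity) fun j => ?_
  have := h j
  simpa [rest, base, baseWts] using this

lemma rest_ne_zero (hd : ∀ i, 1 ≤ d i) {t : ι → ℂ} (ht : t ∈ LimSol m d p) :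
    rest m d 0 t 1 (d p - 1) ≠ 0 := by
  intro h
  have : Nonempty ι := ⟨p⟩
  refine not_forall_rest_eq_zero (m := m) hd ht.2.1 ht.2.2.1 fun i => ?_
  by_cases hi : i = p
  · rw [hi, ht.1, h]
  · exact ht.2.2.2 i hi

/-- The limiting configurations, together with the position of `tₚ` at the smaller scale. -/
def LimPt (m : ℕ) (d : ι → ℕ) (p : ι) : Set (ι → ℂ) :=
  {x | Function.update x p 1 ∈ LimSol m d p ∧
    x p ^ (d p - 1) * rest m d 0 (Function.update x p 1) 1 (d p - 1) + 1 / (d p - 1 : ℕ) = 0}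

lemma ne_zero_of_mem_LimPt (hd : 2 ≤ d p) {x : ι → ℂ} (hx : x ∈ LimPt m d p) : x p ≠ 0 := by
  intro h
  have h1 := hx.2
  have h2 : d p - 1 ≠ 0 := by omega
  rw [h, zero_pow h2, zero_mul, zero_add] at h1
  simp [h2] at h1

/-- The blow-up coordinates near the limiting configurations. -/
def blowUp (p : ι) (v : ℂ × (ι → ℂ)) : ι → ℂ := Function.update v.2 p (1 - v.1 * v.2 p)

/-- The residues in blow-up coordinates. -/
noncomputable def blowUpRes (m : ℕ) (d : ι → ℕ) (p : ι) (v : ℂ × (ι → ℂ)) (j : ι) : ℂ :=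
  if j = p then
    scaledRes m d (v.1 ^ (d p - 1)) (v.2 p) (1 - v.1 * v.2 p) (blowUp p v) (d p - 1)
  else expCoeff (powSum (wts m d (v.1 ^ (d p - 1))) (pts (blowUp p v)) (v.2 j)) (d j - 1)

lemma blowUp_zero (x : ι → ℂ) : blowUp p (0, x) = Function.update x p 1 := by simp [blowUp]

lemma contDiff_blowUp {n : WithTop ℕ∞} (i : ι) :
    ContDiff ℂ n (fun v : ℂ × (ι → ℂ) => blowUp p v i) := by
  by_cases h : i = p
  · subst h
    simp only [blowUp, Function.update_self]
    exact contDiff_const.sub (contDiff_fst.mul (contDiff_pi.1 contDiff_snd i))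
  · simp only [blowUp, Function.update_of_ne h]
    exact contDiff_pi.1 contDiff_snd i

lemma contDiff_pow_fst {n : WithTop ℕ∞} (e : ℕ) :
    ContDiff ℂ n (fun v : ℂ × (ι → ℂ) => v.1 ^ e) := contDiff_fst.pow e

lemma blowUp_self (v : ℂ × (ι → ℂ)) : blowUp p v p = 1 - v.1 * v.2 p := by simp [blowUp]

lemma blowUp_of_ne (v : ℂ × (ι → ℂ)) {i : ι} (h : i ≠ p) : blowUp p v i = v.2 i := by
  simp [blowUp, h]

lemma contDiffAt_blowUpRes {x : ι → ℂ} (hx : Function.update x p 1 ∈ LimSol m d p)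
    {n : WithTop ℕ∞} : ContDiffAt ℂ n (blowUpRes m d p) (0, x) := by
  refine contDiffAt_pi.2 fun j => ?_
  have hγ : ContDiff ℂ n (fun v : ℂ × (ι → ℂ) => v.1 ^ (d p - 1)) := contDiff_pow_fst _
  by_cases hj : j = p
  · subst hj
    have hrest : ∀ k, ContDiffAt ℂ n (fun v : ℂ × (ι → ℂ) => rest m d (v.1 ^ (d j - 1))
        (blowUp j v) (blowUp j v j) k) (0, x) := by
      refine contDiffAt_expCoeff (fun l => contDiffAt_powSum
        (q := fun v => base (blowUp j v)) (j := some j) ?_ ?_ ?_ l)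
      · rintro (_ | i)
        · exact (contDiff_const.sub hγ).contDiffAt
        · exact contDiffAt_const
      · rintro (_ | i)
        · exact contDiffAt_const
        · exact (contDiff_blowUp i).contDiffAt
      · intro i hi
        rw [blowUp_zero]
        exact (injective_base hx.2.1 hx.2.2.1).ne hi
    have hb : ∀ k, ContDiff ℂ n (fun v : ℂ × (ι → ℂ) => binomQuot (v.1 ^ (d j - 1)) k) := by
      intro k
      refine (ContDiff.sum fun i _ => ?_).div_const _
      exact contDiff_iff_contDiffAt.2 fun v => contDiffAt_expCoeff (fun _ => hγ.contDiffAt) _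
    have hp := contDiff_pi.1 (contDiff_snd (𝕜 := ℂ) (n := n) (E := ℂ) (F := ι → ℂ)) j
    simp only [blowUpRes, if_true, scaledRes]
    simp only [blowUp_self] at hrest
    refine ((hp.pow _).contDiffAt.mul (hrest _)).add (ContDiffAt.sum fun k _ => ?_)
    refine (ContDiffAt.mul ?_ (hb k).contDiffAt).mul (hrest _)
    exact ((contDiff_const.sub (contDiff_const.sub (contDiff_fst.mul hp))).pow _).contDiffAt
  · simp only [blowUpRes, if_neg hj]
    have key : ContDiffAt ℂ n (fun v : ℂ × (ι → ℂ) => expCoeff (powSum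
        (wts m d (v.1 ^ (d p - 1))) (pts (blowUp p v)) (pts (blowUp p v) (some (some j))))
        (d j - 1)) (0, x) := by
      refine contDiffAt_expCoeff (fun l => contDiffAt_powSum ?_ ?_ ?_ l) _
      · rintro (_ | _ | i)
        · exact (contDiff_const.sub hγ).contDiffAt
        · exact hγ.contDiffAt
        · exact contDiffAt_const
      · rintro (_ | _ | i)
        · exact contDiffAt_const
        · exact contDiffAt_const
        · exact (contDiff_blowUp i).contDiffAt
      · rw [blowUp_zero]
        rintro (_ | _ | i) hi
        · exact (hx.2.2.1 j).symm
        · intro h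
          exact hj (hx.2.1 ((show (1 : ℂ) = _ from h).symm.trans hx.1.symm))
        · exact hx.2.1.ne fun h => hi (by rw [h])
    simpa only [pts, Option.elim'_some, blowUp_of_ne _ hj] using key

lemma blowUpRes_zero_self (hd : 2 ≤ d p) (x : ι → ℂ) : blowUpRes m d p (0, x) p
    = x p ^ (d p - 1) * rest m d 0 (Function.update x p 1) 1 (d p - 1) + 1 / (d p - 1 : ℕ) := by
  have h : d p - 1 ≠ 0 := by omega
  simp only [blowUpRes, if_true, zero_mul, sub_zero, zero_pow h, blowUp_zero]
  exact scaledRes_one _ (by omega)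

lemma blowUpRes_zero_of_ne (hd : 2 ≤ d p) (x : ι → ℂ) {j : ι} (hj : j ≠ p) :
    blowUpRes m d p (0, x) j = rest m d 0 (Function.update x p 1) (x j) (d j - 1) := by
  have h : d p - 1 ≠ 0 := by omega
  simp only [blowUpRes, if_neg hj, zero_pow h, blowUp_zero, expCoeff_powSum_pts_zero]

lemma eq_zero_of_hasDerivAt_blowUpRes (hd : ∀ i, 2 ≤ d i) {x v : ι → ℂ} (hx : x ∈ LimPt m d p)
    (hv : HasDerivAt (fun η : ℂ => blowUpRes m d p (0, x + η • v)) 0 0) : v = 0 := by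
  have hv' := hasDerivAt_pi.1 hv
  set V : Option ι → ℂ := Option.elim' 0 (Function.update v p 0) with hV
  set J : Finset (Option ι) := (univ.erase p).map Function.Embedding.some
  have h1 : ∀ i, 1 ≤ d i := fun i => one_le_two.trans (hd i)
  have hinj := injective_base hx.1.2.1 hx.1.2.2.1
  have hupd : ∀ i ≠ p, Function.update x p 1 i = x i := fun i hi => Function.update_of_ne hi _ _
  have h0 : Function.update (x + (0 : ℂ) • v) p 1 = Function.update x p 1 := by simp
  have key : V = 0 := by
    refine eq_zero_of_variation (J := J) (d := Option.elim' 0 d) hinj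
      (σ := baseWts m d 0) (m := m + d p) ?_ ?_ ?_ ?_ ?_ ?_ ?_
    · simp only [J, Finset.mem_map, Finset.mem_erase, Finset.mem_univ, and_true,
        Function.Embedding.some_apply, forall_exists_index, and_imp, forall_apply_eq_imp_iff₂]
      exact fun j _ => h1 j
    · simp only [J, Finset.mem_map, Finset.mem_erase, Finset.mem_univ, and_true,
        Function.Embedding.some_apply, forall_exists_index, and_imp, forall_apply_eq_imp_iff₂]
      exact fun j _ => rfl
    · have : 0 < Fintype.card ι := Fintype.card_pos_iff.2 ⟨p⟩
      simp only [J, Finset.card_map, Finset.card_erase_of_mem (Finset.mem_univ p), Finset.card_univ,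
        Fintype.card_option]
      omega
    · simp only [J, Finset.sum_map, Function.Embedding.some_apply, Option.elim'_some, baseWts,
        Fintype.sum_option, Option.elim'_none]
      rw [← Finset.add_sum_erase _ _ (Finset.mem_univ p)]
      push_cast
      ring
    · simp only [J, Finset.mem_map, Finset.mem_erase, Finset.mem_univ, and_true,
        Function.Embedding.some_apply, forall_exists_index, and_imp, forall_apply_eq_imp_iff₂]
      exact hx.1.2.2.2
    · rintro (_ | i) hi
      · rfl
      · have : i = p := by simpa [J] using hi
        simp [hV, this]
    · simp only [J, Finset.mem_map, Finset.mem_erase, Finset.mem_univ, and_true,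
        Function.Embedding.some_apply, forall_exists_index, and_imp, forall_apply_eq_imp_iff₂]
      intro j hj
      have := hasDerivAt_expCoeff_powSum (baseWts m d 0) (v := V) (η := 0)
        (q := fun η : ℂ => base (Function.update (x + η • v) p 1))
        (by rw [h0]; exact hinj) (by
          rintro (_ | i)
          · exact hasDerivAt_const _ _
          · by_cases hi : i = p
            · subst hi
              simpa [base, hV] using hasDerivAt_const (0 : ℂ) (1 : ℂ)
            · simpa [base, hV, hi] using
                ((hasDerivAt_id (0 : ℂ)).mul_const (v i)).const_add (x i)) (some j) (d j - 1)
        (by rw [h0]; exact hx.1.2.2.2 j hj)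
      rw [h0] at this
      refine this.unique ((hv' j).congr_of_eventuallyEq (Eventually.of_forall fun η => ?_))
      simp only [blowUpRes_zero_of_ne (hd p) _ hj, rest]
      simp [base, hj]
  have hvi : ∀ i ≠ p, v i = 0 := fun i hi => by simpa [hV, hi] using congrFun key (some i)
  have hconst : ∀ η : ℂ, Function.update (x + η • v) p 1 = Function.update x p 1 := by
    intro η
    funext i
    by_cases hi : i = p
    · subst hi
      simp
    · simp [hi, hvi i hi]
  have hp := hv' p
  simp only [blowUpRes_zero_self (hd p), hconst] at hp
  have hd1 : HasDerivAt (fun η : ℂ => (x + η • v) p) (v p) 0 := by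
    simpa using ((hasDerivAt_id (0 : ℂ)).mul_const (v p)).const_add (x p)
  have := ((((hd1.fun_pow (d p - 1)).mul_const (rest m d 0 (Function.update x p 1) 1 (d p - 1))).add_const
    (1 / ((d p - 1 : ℕ) : ℂ)))).unique hp
  have hne : ((d p - 1 : ℕ) : ℂ) ≠ 0 := Nat.cast_ne_zero.2 (by have := hd p; omega)
  have hvp : v p = 0 := by
    simpa [hne, rest_ne_zero h1 hx.1, ne_zero_of_mem_LimPt (hd p) hx] using this
  funext i
  by_cases hi : i = p
  · rw [hi, hvp]; rfl
  · exact hvi i hi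

end Chart

section Boundary

variable {ι : Type*} [Fintype ι] [DecidableEq ι] {m : ℕ} {d : ι → ℕ} {p : ι}

lemma blowUp_mem_Sol_iff {γ : ℂ} {v : ℂ × (ι → ℂ)} (hγ : γ = v.1 ^ (d p - 1)) (hv : v.1 ≠ 0)
    (hinj : Function.Injective (pts (blowUp p v))) :
    blowUp p v ∈ Sol m d γ ↔ blowUpRes m d p v = 0 := by
  have hz : 1 - blowUp p v p = v.1 * v.2 p := by rw [blowUp_self]; ring
  have hz0 : 1 - blowUp p v p ≠ 0 := sub_ne_zero.2 ((injective_pts.1 hinj).2.2 p).symm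
  have hp := mul_expCoeff_eq_mul_scaledRes (m := m) (d := d) (t := blowUp p v) hz hz0 hγ
  have hγ0 : γ ≠ 0 := hγ ▸ pow_ne_zero _ hv
  have hiff : ∀ j, expCoeff (powSum (wts m d γ) (pts (blowUp p v)) (blowUp p v j)) (d j - 1) = 0 ↔
      blowUpRes m d p v j = 0 := by
    intro j
    by_cases hj : j = p
    · subst hj
      rw [blowUpRes, if_pos rfl, ← hγ, ← blowUp_self]
      constructor <;> intro h <;> rw [h, mul_zero] at hp
      · exact (mul_eq_zero.1 hp.symm).resolve_left hγ0
      · exact (mul_eq_zero.1 hp).resolve_left (pow_ne_zero _ hz0)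
    · rw [blowUpRes, if_neg hj, ← hγ, blowUp_of_ne _ hj]
  rw [funext_iff]
  exact ⟨fun h j => (hiff j).1 (h.2 j), fun h => ⟨hinj, fun j => (hiff j).2 (h j)⟩⟩

lemma exists_section_LimPt (hd : ∀ i, 2 ≤ d i) {x₀ : ι → ℂ} (hx : x₀ ∈ LimPt m d p) :
    ∃ ψ : ℂ → ι → ℂ, Tendsto ψ (𝓝 0) (𝓝 x₀) ∧ (∀ᶠ ε in 𝓝 0, blowUpRes m d p (ε, ψ ε) = 0) ∧
      ∀ᶠ v in 𝓝 (0, x₀), blowUpRes m d p v = 0 → v.2 = ψ v.1 := by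
  refine exists_implicit_section (contDiffAt_blowUpRes hx.1) ?_
    fun v hv => eq_zero_of_hasDerivAt_blowUpRes hd hx hv
  funext j
  by_cases hj : j = p
  · subst hj
    rw [blowUpRes_zero_self (hd j)]
    exact hx.2
  · rw [blowUpRes_zero_of_ne (hd p) _ hj]
    have := hx.1.2.2.2 j hj
    rwa [Function.update_of_ne hj] at this

/-- The scale at which `tₚ` approaches `1`. -/
noncomputable def scale (e : ℕ) (γ : ℝ) : ℂ := ((γ ^ (1 / (e : ℝ)) : ℝ) : ℂ)

lemma scale_pow {e : ℕ} (he : e ≠ 0) {γ : ℝ} (hγ : 0 < γ) : (γ : ℂ) = scale e γ ^ e := by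
  rw [scale, ← Complex.ofReal_pow, one_div, Real.rpow_inv_natCast_pow hγ.le he]

lemma scale_ne_zero (e : ℕ) {γ : ℝ} (hγ : 0 < γ) : scale e γ ≠ 0 :=
  Complex.ofReal_ne_zero.2 (Real.rpow_pos_of_pos hγ _).ne'

lemma tendsto_ofReal_zero {α : Type*} {F : Filter α} {γ : α → ℝ} (hγ : Tendsto γ F (𝓝 0)) :
    Tendsto (fun a => (γ a : ℂ)) F (𝓝 0) := by
  rw [← Complex.ofReal_zero]
  exact (Complex.continuous_ofReal.tendsto 0).comp hγ

lemma tendsto_scale {e : ℕ} (he : e ≠ 0) : Tendsto (scale e) (𝓝[>] 0) (𝓝 0) := by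
  have h := (Real.continuousAt_rpow_const 0 (1 / (e : ℝ)) (.inr (by positivity))).tendsto
  rw [Real.zero_rpow (by positivity)] at h
  exact tendsto_ofReal_zero (h.mono_left nhdsWithin_le_nhds)

lemma tendsto_blowUp {α : Type*} {F : Filter α} {ε : α → ℂ} {x : α → ι → ℂ} {x₀ : ι → ℂ}
    (hε : Tendsto ε F (𝓝 0)) (hx : Tendsto x F (𝓝 x₀)) :
    Tendsto (fun a => blowUp p (ε a, x a)) F (𝓝 (Function.update x₀ p 1)) := by
  rw [← blowUp_zero]
  have hc : Continuous (blowUp p : ℂ × (ι → ℂ) → ι → ℂ) :=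
    continuous_pi fun i => (contDiff_blowUp (n := 0) i).continuous
  exact (hc.tendsto (0, x₀)).comp (hε.prodMk_nhds hx)

lemma eventually_injective {α : Type*} {F : Filter α} {t : α → ι → ℂ} {t₀ : ι → ℂ}
    (ht : Tendsto t F (𝓝 t₀)) (h : Function.Injective t₀) :
    ∀ᶠ a in F, Function.Injective (t a) := by
  have ht' := tendsto_pi_nhds.1 ht
  have : ∀ᶠ a in F, ∀ i j, i ≠ j → t a i ≠ t a j := by
    refine eventually_all.2 fun i => eventually_all.2 fun j => ?_
    by_cases hij : i = j
    · simp [hij]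
    filter_upwards [((ht' i).sub (ht' j)).eventually_ne (sub_ne_zero.2 (h.ne hij))]
      with a ha _ using sub_ne_zero.1 ha
  exact this.mono fun a ha i j hij => by_contra fun h' => ha i j h' hij

lemma eventually_injective_pts_blowUp {α : Type*} {F : Filter α} {ε : α → ℂ} {x : α → ι → ℂ}
    {x₀ : ι → ℂ} (hd : 2 ≤ d p) (hx₀ : x₀ ∈ LimPt m d p) (hε : Tendsto ε F (𝓝 0))
    (hε0 : ∀ᶠ a in F, ε a ≠ 0) (hx : Tendsto x F (𝓝 x₀)) :
    ∀ᶠ a in F, Function.Injective (pts (blowUp p (ε a, x a))) := by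
  have hlim := tendsto_blowUp (p := p) hε hx
  have hlim' := tendsto_pi_nhds.1 hlim
  have h0 : ∀ᶠ a in F, ∀ i, blowUp p (ε a, x a) i ≠ 0 :=
    eventually_all.2 fun i => (hlim' i).eventually_ne (hx₀.1.2.2.1 i)
  have h1 : ∀ᶠ a in F, ∀ i, blowUp p (ε a, x a) i ≠ 1 := by
    refine eventually_all.2 fun i => ?_
    by_cases hi : i = p
    · subst hi
      filter_upwards [hε0, (tendsto_pi_nhds.1 hx i).eventually_ne (ne_zero_of_mem_LimPt hd hx₀)]
        with a ha ha'
      simp [blowUp_self, ha, ha']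
    · refine (hlim' i).eventually_ne fun h => hi ?_
      exact hx₀.1.2.1 (h.trans hx₀.1.1.symm)
  filter_upwards [eventually_injective hlim hx₀.1.2.1, h0, h1] with a h h' h''
  exact injective_pts.2 ⟨h, h', h''⟩

section Ultra

variable {α : Type*} {𝒰 : Ultrafilter α} {γ : α → ℝ} {t : α → ι → ℂ} {t₀ : ι → ℂ}

lemma rest_eq_zero_of_tendsto (hγ : Tendsto γ 𝒰 (𝓝 0)) (ht : ∀ᶠ a in 𝒰, t a ∈ Sol m d (γ a))
    (hlim : Tendsto t 𝒰 (𝓝 t₀)) (hinj : Function.Injective t₀) (h0 : ∀ i, t₀ i ≠ 0) {j : ι}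
    (hj : t₀ j ≠ 1) : rest m d 0 t₀ (t₀ j) (d j - 1) = 0 := by
  have := tendsto_expCoeff (F := (𝒰 : Filter α)) (tendsto_powSum (σ := fun a => wts m d (γ a))
    (q := fun a => pts (t a)) (q₀ := pts t₀) (tendsto_wts hγ) (by
      rintro (_ | _ | i)
      · exact tendsto_const_nhds
      · exact tendsto_const_nhds
      · exact tendsto_pi_nhds.1 hlim i) (j := some (some j)) (by
      rintro (_ | _ | i) hi
      · exact (h0 j).symm
      · exact hj.symm
      · exact hinj.ne fun h => hi (by rw [h]))) (d j - 1)
  rw [Complex.ofReal_zero, expCoeff_powSum_pts_zero] at this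
  exact tendsto_nhds_unique (this.congr' (ht.mono fun a ha => ha.2 j)) tendsto_const_nhds

lemma tendsto_rest (hγ : Tendsto γ 𝒰 (𝓝 0)) (hlim : Tendsto t 𝒰 (𝓝 t₀))
    (hinj : Function.Injective t₀) (h0 : ∀ i, t₀ i ≠ 0) (j : ι) (k : ℕ) :
    Tendsto (fun a => rest m d (γ a) (t a) (t a j) k) 𝒰 (𝓝 (rest m d 0 t₀ (t₀ j) k)) := by
  have hc : Tendsto (fun a => (γ a : ℂ)) 𝒰 (𝓝 0) :=
    tendsto_ofReal_zero hγ
  refine tendsto_expCoeff (fun l => tendsto_powSum (σ := fun a => baseWts m d (γ a))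
    (q := fun a => base (t a)) (j := some j) ?_ ?_
    (fun i hi => (injective_base hinj h0).ne hi) l) k
  · rintro (_ | i)
    · exact tendsto_const_nhds.sub hc
    · exact tendsto_const_nhds
  · rintro (_ | i)
    · exact tendsto_const_nhds
    · exact tendsto_pi_nhds.1 hlim i

lemma exists_tendsto_of_tendsto_pow {u : α → ℂ} {w : ℂ} {e : ℕ} (he : e ≠ 0)
    (h : Tendsto (fun a => u a ^ e) 𝒰 (𝓝 w)) : ∃ z, Tendsto u 𝒰 (𝓝 z) ∧ z ^ e = w := by
  have : ∀ᶠ a in (𝒰 : Filter α), ‖u a‖ ≤ max 1 (‖w‖ + 1) := by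
    filter_upwards [h.norm.eventually (gt_mem_nhds (lt_add_one ‖w‖))] with a ha
    rcases le_total ‖u a‖ 1 with h1 | h1
    · exact h1.trans (le_max_left _ _)
    · refine le_trans ?_ (le_max_right _ _)
      rw [norm_pow] at ha
      exact (le_self_pow₀ h1 he).trans ha.le
  obtain ⟨z, hz⟩ := exists_tendsto_of_bounded 𝒰 this
  exact ⟨z, hz, tendsto_nhds_unique (hz.pow e) h⟩

lemma exists_tendsto_mem_LimPt (hd : 2 ≤ d p) (hγ : Tendsto γ 𝒰 (𝓝 0)) (hγ0 : ∀ᶠ a in 𝒰, 0 < γ a)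
    (ht : ∀ᶠ a in 𝒰, t a ∈ Sol m d (γ a)) (hlim : Tendsto t 𝒰 (𝓝 t₀))
    (ht₀ : t₀ ∈ LimSol m d p) (hρ : rest m d 0 t₀ 1 (d p - 1) ≠ 0) :
    ∃ x₀ ∈ LimPt m d p, Tendsto (fun a => Function.update (t a) p
      ((1 - t a p) / scale (d p - 1) (γ a))) 𝒰 (𝓝 x₀) := by
  set e := d p - 1 with he
  have he0 : e ≠ 0 := by omega
  set u : α → ℂ := fun a => (1 - t a p) / scale e (γ a) with hu
  have hr : ∀ k, Tendsto (fun a => rest m d (γ a) (t a) (t a p) k) 𝒰 (𝓝 (rest m d 0 t₀ 1 k)) := by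
    intro k
    simpa [ht₀.1] using tendsto_rest (m := m) (d := d) hγ hlim ht₀.2.1 ht₀.2.2.1 p k
  have hb : ∀ k, Tendsto (fun a => binomQuot (γ a) k) 𝒰 (𝓝 (binomQuot 0 k)) := by
    intro k
    refine Tendsto.div_const (tendsto_finsetSum _ fun i _ => tendsto_expCoeff (fun _ => ?_) i) _
    exact tendsto_ofReal_zero hγ
  have hz : Tendsto (fun a => t a p) 𝒰 (𝓝 1) := by
    simpa [ht₀.1] using tendsto_pi_nhds.1 hlim p
  have hsum : Tendsto (fun a => scaledRes m d (γ a) 0 (t a p) (t a) e) 𝒰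
      (𝓝 (scaledRes m d 0 0 1 t₀ e)) := by
    refine (tendsto_const_nhds.mul (hr e)).add (tendsto_finsetSum _ fun k _ => ?_)
    exact ((((tendsto_const_nhds.sub hz).pow _).mul (hb k)).mul (hr _))
  rw [scaledRes_one _ (Nat.one_le_iff_ne_zero.2 he0), zero_pow he0, zero_mul, zero_add] at hsum
  have hpow : Tendsto (fun a => u a ^ e) 𝒰 (𝓝 (-(1 / (e : ℂ)) / rest m d 0 t₀ 1 e)) := by
    refine (hsum.neg.div (hr e) hρ).congr' ?_
    filter_upwards [hγ0, ht, (hr e).eventually_ne hρ] with a h1 h2 h3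
    have hs := scale_ne_zero e h1
    have hz0 : 1 - t a p ≠ 0 := sub_ne_zero.2 ((injective_pts.1 h2.1).2.2 p).symm
    have := mul_expCoeff_eq_mul_scaledRes (m := m) (d := d) (t := t a) (u := u a)
      (z := t a p) (mul_div_cancel₀ (1 - t a p) hs).symm hz0 (scale_pow he0 h1)
    rw [h2.2 p, mul_zero, eq_comm, mul_eq_zero_iff_left (Complex.ofReal_ne_zero.2 h1.ne')] at this
    simp only [Pi.div_apply]
    rw [div_eq_iff h3]
    simp only [scaledRes, zero_pow he0, zero_mul, zero_add] at this ⊢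
    linear_combination -this
  obtain ⟨u₀, hu₀, hu₀'⟩ := exists_tendsto_of_tendsto_pow he0 hpow
  have hupd : Function.update (Function.update t₀ p u₀) p 1 = t₀ := by
    rw [Function.update_idem, ← ht₀.1, Function.update_eq_self]
  refine ⟨Function.update t₀ p u₀, ⟨by rwa [hupd], ?_⟩, ?_⟩
  · rw [hupd, Function.update_self, ← he, hu₀', div_mul_cancel₀ _ hρ, neg_add_cancel]
  · rw [tendsto_pi_nhds]
    intro i
    by_cases hi : i = p
    · subst hi
      simpa using hu₀
    · simpa [hi] using tendsto_pi_nhds.1 hlim i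

end Ultra

lemma eventually_ncard_Sol_eq_card_LimPt [Nonempty ι] (hd : ∀ i, 2 ≤ d i)
    [Finite (Σ p, LimPt m d p)] :
    ∀ᶠ γ : ℝ in 𝓝[>] 0, (Sol m d γ).ncard = Nat.card (Σ p, LimPt m d p) := by
  have hd1 : ∀ i, 1 ≤ d i := fun i => one_le_two.trans (hd i)
  have he : ∀ i, d i - 1 ≠ 0 := fun i => by have := hd i; omega
  choose ψ h1 h2 h3 using fun y : Σ p, LimPt m d p => exists_section_LimPt hd y.2.2
  have hψ : ∀ y : Σ p, LimPt m d p,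
      Tendsto (fun γ => ψ y (scale (d y.1 - 1) γ)) (𝓝[>] 0) (𝓝 y.2) :=
    fun y => (h1 y).comp (tendsto_scale (he _))
  have hpos : ∀ᶠ γ : ℝ in 𝓝[>] 0, 0 < γ := self_mem_nhdsWithin
  have hs0 : ∀ e, ∀ᶠ γ in 𝓝[>] 0, scale e γ ≠ 0 := fun e => hpos.mono fun γ h => scale_ne_zero e h
  refine (eventually_ncard_eq (S := fun γ : ℝ => Sol m d γ) (l := 𝓝[>] 0)
    (fun (y : Σ p, LimPt m d p) γ =>
      blowUp y.1 (scale (d y.1 - 1) γ, ψ y (scale (d y.1 - 1) γ))) ?_ ?_ ?_).mono fun γ h => h.2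
  · intro y
    filter_upwards [hpos, (tendsto_scale (he y.1)).eventually (h2 y),
      eventually_injective_pts_blowUp (hd _) y.2.2 (tendsto_scale (he _)) (hs0 _) (hψ y)]
      with γ h h' h''
    exact (blowUp_mem_Sol_iff (scale_pow (he _) h) (scale_ne_zero _ h) h'').2 h'
  · rintro ⟨p, x⟩ ⟨p', x'⟩ hne
    by_cases hp : p = p'
    · subst hp
      have hxx : (x : ι → ℂ) ≠ x' := fun h => hne (by rw [Subtype.ext h])
      filter_upwards [hs0 (d p - 1),
        ((hψ ⟨p, x⟩).sub (hψ ⟨p, x'⟩)).eventually_ne (sub_ne_zero.2 hxx)] with γ h h' heq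
      refine sub_ne_zero.1 h' (funext fun i => ?_)
      have := congrFun heq i
      by_cases hi : i = p
      · subst hi
        simpa [blowUp_self, h] using this
      · simpa [blowUp_of_ne _ hi] using this
    · have hl := tendsto_pi_nhds.1 (tendsto_blowUp (p := p) (tendsto_scale (he p)) (hψ ⟨p, x⟩)) p
      have hl' := tendsto_pi_nhds.1 (tendsto_blowUp (p := p') (tendsto_scale (he p')) (hψ ⟨p', x'⟩)) p
      have hlne : Function.update (x : ι → ℂ) p 1 p - Function.update (x' : ι → ℂ) p' 1 p ≠ 0 := by
        have h := x'.2.1.2.1.ne (Ne.symm hp)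
        rw [x'.2.1.1] at h
        rw [x.2.1.1]
        exact sub_ne_zero.2 h
      filter_upwards [(hl.sub hl').eventually_ne hlne] with γ h heq
      exact h (by rw [heq, sub_self])
  · intro 𝒰 t hle ht
    have hγ : Tendsto (fun γ : ℝ => γ) 𝒰 (𝓝 0) := hle.trans nhdsWithin_le_nhds
    obtain ⟨t₀, hlim, hinj, h0, -⟩ := exists_tendsto_of_mem_Sol hd1 hγ le_rfl (by positivity) ht
    have hres := fun j => rest_eq_zero_of_tendsto hγ ht hlim hinj h0 (j := j)
    obtain ⟨p, hp⟩ : ∃ p, t₀ p = 1 := by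
      by_contra! hcon
      exact not_forall_rest_eq_zero hd1 hinj h0 fun i => hres i (hcon i)
    have ht₀ : t₀ ∈ LimSol m d p :=
      ⟨hp, hinj, h0, fun i hi => hres i fun h => hi (hinj (h.trans hp.symm))⟩
    obtain ⟨x₀, hx₀, hx⟩ := exists_tendsto_mem_LimPt (hd p) hγ (hle hpos) ht hlim ht₀
      (rest_ne_zero hd1 ht₀)
    refine ⟨⟨p, x₀, hx₀⟩, ?_⟩
    have hs : Tendsto (scale (d p - 1)) 𝒰 (𝓝 0) := (tendsto_scale (he p)).mono_left hle
    filter_upwards [(hs.prodMk_nhds hx).eventually (h3 ⟨p, x₀, hx₀⟩), hle hpos, ht] with γ h h' h''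
    have hsc := scale_ne_zero (d p - 1) h'
    have hb : blowUp p (scale (d p - 1) γ,
        Function.update (t γ) p ((1 - t γ p) / scale (d p - 1) γ)) = t γ := by
      simp [blowUp, mul_div_cancel₀ _ hsc]
    have := h ((blowUp_mem_Sol_iff (scale_pow (he p) h') hsc (by rw [hb]; exact h''.1)).1
      (by rw [hb]; exact h''))
    rw [← this, hb]

end Boundary

section Count

lemma card_pow_eq {e : ℕ} (he : e ≠ 0) {w : ℂ} (hw : w ≠ 0) :
    Finite {u : ℂ // u ^ e = w} ∧ Nat.card {u : ℂ // u ^ e = w} = e := by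
  have hζ := Complex.isPrimitiveRoot_exp e he
  have hset : ∀ u, u ∈ (Polynomial.nthRoots e w).toFinset ↔ u ^ e = w := fun u => by
    rw [Multiset.mem_toFinset, Polynomial.mem_nthRoots (Nat.pos_of_ne_zero he)]
  have hcard : (Polynomial.nthRoots e w).toFinset.card = e := by
    rw [Multiset.toFinset_card_of_nodup (hζ.nthRoots_nodup hw), hζ.card_nthRoots, if_pos]
    exact IsAlgClosed.exists_pow_nat_eq w (Nat.pos_of_ne_zero he)
  have hF : Finite {u : ℂ // u ^ e = w} :=
    (Finset.finite_toSet _).subset fun u (hu : u ^ e = w) => Finset.mem_coe.2 ((hset u).2 hu)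
  refine ⟨hF, ?_⟩
  rw [Nat.card_congr (Equiv.subtypeEquivRight fun u => (hset u).symm), Nat.card_eq_fintype_card,
    Fintype.card_coe, hcard]

variable {ι : Type*} [Fintype ι] [DecidableEq ι] {m : ℕ} {d : ι → ℕ} {p : ι}

lemma rest_eq_reduced {t : ι → ℂ} (ht : t p = 1) (z : ℂ) (k : ℕ) : rest m d 0 t z k
    = expCoeff (powSum (wts (m + d p) (fun i : {i // i ≠ p} => d i) (d p))
      (pts fun i : {i // i ≠ p} => t i) z) k := by
  rw [rest]
  congr 1
  funext l
  simp only [powSum, wts, pts, baseWts, base, Fintype.sum_option, Option.elim'_none,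
    Option.elim'_some]
  rw [Fintype.sum_eq_add_sum_subtype_ne _ p, ht]
  push_cast
  ring

/-- The limiting configurations solve a problem of the same kind with `tₚ` placed at `1`. -/
noncomputable def limSolEquiv (m : ℕ) (d : ι → ℕ) (p : ι) :
    LimSol m d p ≃ Sol (m + d p) (fun i : {i // i ≠ p} => d i) (d p) where
  toFun t := ⟨fun i => t.1 i, by
    obtain ⟨t, hp, hi, h0, h⟩ := t
    refine ⟨injective_pts.2 ⟨fun i j hij => Subtype.ext (hi hij), fun i => h0 i, fun i hi' =>
      i.2 (hi (hi'.trans hp.symm))⟩, fun j => ?_⟩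
    rw [← rest_eq_reduced hp]
    exact h j j.2⟩
  invFun τ := ⟨fun i => if h : i = p then 1 else τ.1 ⟨i, h⟩, by
    obtain ⟨τ, hi, h⟩ := τ
    obtain ⟨hi, h0, h1⟩ := injective_pts.1 hi
    refine ⟨by simp, fun i j hij => ?_, fun i => ?_, fun i hip => ?_⟩
    · by_cases hi' : i = p <;> by_cases hj' : j = p <;> simp only [hi', hj', dite_true, dite_false] at hij ⊢
      · exact absurd hij.symm (h1 _)
      · exact absurd hij (h1 _)
      · simpa using hi hij
    · by_cases hi' : i = p
      · simp [hi']
      · simpa [hi'] using h0 ⟨i, hi'⟩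
    · rw [rest_eq_reduced (dif_pos rfl)]
      have := h ⟨i, hip⟩
      simp only [hip, dite_false]
      refine Eq.trans ?_ this
      congr 3
      funext j
      simp [j.2]⟩
  left_inv t := by
    ext i
    by_cases h : i = p
    · subst h
      simp [t.2.1]
    · simp [h]
  right_inv τ := by
    ext i
    simp [i.2]

lemma update_update_one {t : ι → ℂ} (ht : t p = 1) (u : ℂ) :
    Function.update (Function.update t p u) p 1 = t := by
  rw [Function.update_idem, ← ht, Function.update_eq_self]

/-- The position of `tₚ` at the smaller scale is determined up to a root of unity. -/
noncomputable def limPtEquiv (hd : ∀ i, 1 ≤ d i) : LimPt m d p ≃ Σ t : LimSol m d p,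
    {u : ℂ // u ^ (d p - 1) = -(1 / (d p - 1 : ℕ)) / rest m d 0 t 1 (d p - 1)} where
  toFun x := ⟨⟨_, x.2.1⟩, ⟨x.1 p, by
    rw [eq_div_iff (rest_ne_zero hd x.2.1)]
    exact eq_neg_of_add_eq_zero_left x.2.2⟩⟩
  invFun y := ⟨Function.update y.1.1 p y.2.1, by
    have h := update_update_one y.1.2.1 y.2.1
    refine ⟨by rw [h]; exact y.1.2, ?_⟩
    rw [h, Function.update_self, y.2.2, div_mul_cancel₀ _ (rest_ne_zero hd y.1.2), neg_add_cancel]⟩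
  left_inv x := by simp
  right_inv y := by
    obtain ⟨⟨t, ht⟩, u, hu⟩ := y
    have h := update_update_one ht.1 u
    simp only [Function.update_self]
    refine Sigma.ext (Subtype.ext h) ?_
    refine (Subtype.heq_iff_coe_eq ?_).2 rfl
    intro x
    simp only [h]

lemma card_LimPt (hd : ∀ i, 2 ≤ d i) : Finite (LimPt m d p) ∧ Nat.card (LimPt m d p)
    = (d p - 1) * (Sol (m + d p) (fun i : {i // i ≠ p} => d i) (d p : ℝ)).ncard := by
  have hd1 : ∀ i, 1 ≤ d i := fun i => one_le_two.trans (hd i)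
  have he : d p - 1 ≠ 0 := by have := hd p; omega
  have hpos : (0 : ℝ) < d p := Nat.cast_pos.2 (hd1 p)
  have hfin : Finite (Sol (m + d p) (fun i : {i // i ≠ p} => d i) (d p : ℝ)) :=
    finite_Sol (ι := {i // i ≠ p}) (d := fun i => d i) (m := m + d p) (fun i => hd1 i) hpos (by push_cast; linarith [(Nat.cast_nonneg m : (0 : ℝ) ≤ m)])
  rw [Complex.ofReal_natCast] at hfin ⊢
  have hfin' : Finite (LimSol m d p) := Finite.of_equiv _ (limSolEquiv m d p).symm
  have : Fintype (LimSol m d p) := Fintype.ofFinite _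
  have hroot := fun t : LimSol m d p => card_pow_eq he
    (w := -(1 / (d p - 1 : ℕ)) / rest m d 0 t 1 (d p - 1)) (div_ne_zero
      (neg_ne_zero.2 (one_div_ne_zero (Nat.cast_ne_zero.2 he))) (rest_ne_zero hd1 t.2))
  have := fun t => (hroot t).1
  refine ⟨Finite.of_equiv _ (limPtEquiv hd1).symm, ?_⟩
  rw [Nat.card_congr (limPtEquiv hd1), Nat.card_sigma, Finset.sum_congr rfl fun t _ => (hroot t).2,
    Finset.sum_const, Finset.card_univ, smul_eq_mul, mul_comm, ← Nat.card_eq_fintype_card,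
    Nat.card_congr (limSolEquiv m d p), Nat.card_coe_set_eq]

end Count

lemma ncard_Sol (n : ℕ) : ∀ {ι : Type} [Fintype ι] [DecidableEq ι] {m : ℕ} {d : ι → ℕ},
    Fintype.card ι = n → (∀ i, 2 ≤ d i) → ∀ {γ : ℝ}, 0 < γ → γ < m + 2 →
    (Sol m d γ).ncard = n.factorial * ∏ i, (d i - 1) := by
  induction n with
  | zero =>
    intro ι _ _ m d hι _ γ _ _
    have := Fintype.card_eq_zero_iff.1 hι
    have huniv : Sol m d γ = Set.univ := Set.eq_univ_of_forall fun t =>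
      ⟨injective_pts.2 ⟨Function.injective_of_subsingleton t, isEmptyElim, isEmptyElim⟩, isEmptyElim⟩
    rw [huniv, Set.ncard_univ]
    simp
  | succ n ih =>
    intro ι _ _ m d hι hd γ h0 h2
    have hne : Nonempty ι := Fintype.card_pos_iff.1 (by omega)
    have hd1 : ∀ i, 1 ≤ d i := fun i => one_le_two.trans (hd i)
    have hfin := fun p => (card_LimPt (m := m) (p := p) hd).1
    have hm : (0 : ℝ) < m + 2 := by positivity
    obtain ⟨γ', h, h'⟩ := ((eventually_ncard_Sol_eq_card_LimPt (m := m) hd).and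
      (Ioo_mem_nhdsGT hm)).exists
    rw [ncard_Sol_eq hd1 ⟨h0, h2⟩ h', h, Nat.card_sigma]
    have hp : ∀ p, Nat.card (LimPt m d p) = n.factorial * ∏ i, (d i - 1) := by
      intro p
      rw [(card_LimPt hd).2, ih (ι := {i // i ≠ p}) (m := m + d p) (d := fun i => d i)
        (by simp [Fintype.card_subtype_compl, hι]) (fun i => hd i)
        (Nat.cast_pos.2 (hd1 p)) (by push_cast; linarith [(Nat.cast_nonneg m : (0 : ℝ) ≤ m)]),
        Fintype.prod_eq_mul_prod_subtype_ne _ p]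
      ring
    rw [Finset.sum_congr rfl fun p _ => hp p, Finset.sum_const, Finset.card_univ, hι, smul_eq_mul,
      Nat.factorial_succ]
    ring

section Residue

lemma expSeries_zero : expSeries (fun _ => 0) = 1 := by
  have := eq_C_mul_expSeries (L := fun _ => 0) (y := 1) (by ext; simp)
  simpa using this.symm

lemma expSeries_ne_zero (L : ℕ → ℂ) : expSeries L ≠ 0 := fun h => by
  simpa [h] using constantCoeff_expSeries L

lemma expSeries_sum {κ : Type*} (s : Finset κ) (L : κ → ℕ → ℂ) :
    expSeries (fun l => ∑ i ∈ s, L i l) = ∏ i ∈ s, expSeries (L i) := by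
  classical
  induction s using Finset.induction_on with
  | empty => simpa using expSeries_zero
  | insert i s hi ih => simp only [Finset.sum_insert hi, Finset.prod_insert hi, expSeries_add, ih]

lemma ofPowerSeries_expSeries_zpow (L : ℕ → ℂ) (k : ℤ) :
    HahnSeries.ofPowerSeries ℤ ℂ (expSeries fun l => k * L l)
      = HahnSeries.ofPowerSeries ℤ ℂ (expSeries L) ^ k := by
  have h0 : HahnSeries.ofPowerSeries ℤ ℂ (expSeries L) ≠ 0 :=
    (map_ne_zero_iff _ HahnSeries.ofPowerSeries_injective).2 (expSeries_ne_zero L)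
  have hsucc : ∀ k : ℤ, HahnSeries.ofPowerSeries ℤ ℂ (expSeries fun l => (k + 1 : ℤ) * L l)
      = HahnSeries.ofPowerSeries ℤ ℂ (expSeries fun l => k * L l)
        * HahnSeries.ofPowerSeries ℤ ℂ (expSeries L) := fun k => by
    rw [← map_mul, ← expSeries_add]
    congr 2
    funext l
    push_cast
    ring
  induction k using Int.induction_on with
  | zero => simp [expSeries_zero]
  | succ k ih => rw [hsucc, ih, zpow_add_one₀ h0]
  | pred k ih =>
    rw [zpow_sub_one₀ h0, ← ih, eq_mul_inv_iff_mul_eq₀ h0, ← hsucc, sub_add_cancel]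

lemma X_sub_C_eq {u : ℂ} (hu : u ≠ 0) : (PowerSeries.X - PowerSeries.C u : PowerSeries ℂ)
    = PowerSeries.C (-u) * expSeries fun l => -(u⁻¹) ^ (l + 1) := by
  have h := eq_C_mul_expSeries (L := fun l => -(u⁻¹) ^ (l + 1))
    (y := PowerSeries.X - PowerSeries.C u) (by
      ext k
      rcases k with _ | k
      · simp [sub_mul, hu]
      · simp only [sub_mul, map_sub, PowerSeries.derivative_X, PowerSeries.derivative_C, sub_zero,
          PowerSeries.coeff_succ_X_mul, PowerSeries.coeff_C_mul, PowerSeries.coeff_mk,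
          PowerSeries.coeff_one, Nat.add_one_ne_zero, if_false]
        rw [pow_succ' _ (k + 1), mul_neg, mul_inv_cancel_left₀ hu]
        ring)
  simpa using h

lemma laurent_omegaZ {N : ℕ} {μ : Fin N → ℤ} {Z : Fin N → ℂ} (hZ : Function.Injective Z)
    (j : Fin N) : ∃ w : ℂ, w ≠ 0 ∧
      ((RatFunc.laurent (Z j) (omegaZ μ Z) : RatFunc ℂ) : LaurentSeries ℂ)
        = HahnSeries.single (μ j) w * HahnSeries.ofPowerSeries ℤ ℂ
          (expSeries (powSum (fun i => -(μ i : ℂ)) Z (Z j))) := by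
  refine ⟨∏ i ∈ univ.erase j, (-(Z i - Z j)) ^ μ i, Finset.prod_ne_zero_iff.2 fun i hi =>
    zpow_ne_zero _ (neg_ne_zero.2 (sub_ne_zero.2 fun h => (Finset.mem_erase.1 hi).1 (hZ h))), ?_⟩
  have hlin : ∀ i, ((RatFunc.laurent (Z j) (RatFunc.X - RatFunc.C (Z i)) : RatFunc ℂ) :
      LaurentSeries ℂ) = HahnSeries.ofPowerSeries ℤ ℂ
        (PowerSeries.X - PowerSeries.C (Z i - Z j)) := fun i => by
    have := RatFunc.coe_coe (F := ℂ) (Polynomial.X - Polynomial.C (Z i - Z j))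
    rw [map_sub, RatFunc.laurent_X, RatFunc.laurent_C]
    rw [RatFunc.coePolynomial, map_sub (algebraMap (Polynomial ℂ) (RatFunc ℂ)), RatFunc.algebraMap_X, RatFunc.algebraMap_C,
      Polynomial.coe_sub, Polynomial.coe_X, Polynomial.coe_C] at this
    rw [this]
    simp only [map_sub, map_add]
    ring
  rw [omegaZ, map_prod, map_prod, ← Finset.mul_prod_erase _ _ (Finset.mem_univ j)]
  have hpow : ∀ i ∈ univ.erase j,
      ((RatFunc.laurent (Z j) ((RatFunc.X - RatFunc.C (Z i)) ^ μ i) : RatFunc ℂ) : LaurentSeries ℂ)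
      = HahnSeries.C ((-(Z i - Z j)) ^ μ i) * HahnSeries.ofPowerSeries ℤ ℂ
          (expSeries fun l => -(μ i : ℂ) * ((Z i - Z j)⁻¹) ^ (l + 1)) := fun i hi => by
    have hu : Z i - Z j ≠ 0 := sub_ne_zero.2 fun h => (Finset.mem_erase.1 hi).1 (hZ h)
    rw [map_zpow₀, map_zpow₀, hlin, X_sub_C_eq hu, map_mul, mul_zpow,
      ← ofPowerSeries_expSeries_zpow, HahnSeries.ofPowerSeries_C, map_zpow₀]
    simp
  rw [Finset.prod_congr rfl hpow, Finset.prod_mul_distrib, ← map_prod, ← map_prod, ← expSeries_sum,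
    map_zpow₀, map_zpow₀, hlin, sub_self, map_zero, sub_zero, HahnSeries.ofPowerSeries_X,
    ← mul_assoc]
  congr 1
  · rw [← RatFunc.single_zpow, HahnSeries.C_apply, HahnSeries.single_mul_single]
    simp
  · congr 2
    funext l
    rw [powSum, ← Finset.add_sum_erase _ _ (Finset.mem_univ j)]
    simp

lemma residueAt_omegaZ_eq_zero_iff {N : ℕ} {μ : Fin N → ℤ} {Z : Fin N → ℂ}
    (hZ : Function.Injective Z) {j : Fin N} {e : ℕ} (he : 1 ≤ e) (hj : μ j = -(e : ℤ)) :
    residueAt (Z j) (omegaZ μ Z) = 0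
      ↔ expCoeff (powSum (fun i => -(μ i : ℂ)) Z (Z j)) (e - 1) = 0 := by
  obtain ⟨w, hw, h⟩ := laurent_omegaZ (μ := μ) hZ j
  rw [residueAt, h, HahnSeries.coeff_single_mul, mul_eq_zero, or_iff_right hw, hj,
    show (-1 - -(e : ℤ)) = ((e - 1 : ℕ) : ℤ) by omega, LaurentSeries.coeff_coe_powerSeries,
    coeff_expSeries]

end Residue

section Moebius

lemma expCoeff_translate {κ : Type*} (s : Finset κ) (σ x : κ → ℂ) {e : ℕ} (he : 1 ≤ e)
    (hσ : ∑ i ∈ s, σ i + (e - 1 : ℕ) = 0) (k : ℂ) :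
    expCoeff (fun l => ∑ i ∈ s, σ i * (x i + k) ^ (l + 1)) e
      = expCoeff (fun l => ∑ i ∈ s, σ i * x i ^ (l + 1)) e := by
  have hderiv : ∀ k, HasDerivAt
      (fun k => expCoeff (fun l => ∑ i ∈ s, σ i * (x i + k) ^ (l + 1)) e) 0 k := fun k => by
    set L : ℕ → ℂ := fun l => ∑ i ∈ s, σ i * (x i + k) ^ (l + 1) with hL
    have := hasDerivAt_expCoeff (L := fun k l => ∑ i ∈ s, σ i * (x i + k) ^ (l + 1)) (η := k)
      (Q := PowerSeries.X * (PowerSeries.C (∑ i ∈ s, σ i) + PowerSeries.X * PowerSeries.mk L))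
      (by simp) (fun l => ?_) e
    · refine this.congr_deriv ?_
      have h2 : expSeries L * (PowerSeries.X * (PowerSeries.C (∑ i ∈ s, σ i)
            + PowerSeries.X * PowerSeries.mk L))
          = PowerSeries.X * (PowerSeries.C (∑ i ∈ s, σ i) * expSeries L
            + PowerSeries.X * PowerSeries.derivative ℂ (expSeries L)) := by
        rw [derivative_expSeries]
        ring
      obtain ⟨e, rfl⟩ := Nat.exists_eq_add_of_le' he
      rw [h2, PowerSeries.coeff_succ_X_mul, map_add, PowerSeries.coeff_C_mul]
      rw [Nat.add_sub_cancel] at hσ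
      rcases e with _ | e
      · simpa using hσ
      · rw [PowerSeries.coeff_succ_X_mul, PowerSeries.coeff_derivative]
        push_cast at hσ
        linear_combination (PowerSeries.coeff (e + 1) (expSeries L)) * hσ
    · have h := HasDerivAt.fun_sum (u := s) fun i _ =>
        (((hasDerivAt_id k).const_add (x i)).pow (l + 1)).const_mul (σ i)
      refine h.congr_deriv ?_
      rw [PowerSeries.coeff_succ_X_mul]
      rcases l with _ | l
      · simp
      · simp only [map_add, PowerSeries.coeff_succ_X_mul, PowerSeries.coeff_mk, hL,
          PowerSeries.coeff_C, Nat.add_one_ne_zero, if_false, zero_add, Finset.mul_sum]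
        refine Finset.sum_congr rfl fun i _ => ?_
        simp
        ring
  have := is_const_of_deriv_eq_zero (fun k => (hderiv k).differentiableAt)
    (fun k => (hderiv k).deriv) k 0
  simpa using this

/-- Sending `Z i₀` to infinity by a Möbius transformation preserves the residue condition. -/
lemma expCoeff_moebius {κ : Type*} [Fintype κ] [DecidableEq κ] {σ Z : κ → ℂ}
    (hZ : Function.Injective Z) (hσ : ∑ i, σ i = 2) {e : ℕ} (he : 1 ≤ e) {i₀ j : κ} (hj : j ≠ i₀)
    (hσj : σ j = (e + 1 : ℕ)) {z K : ℂ} (hz : z ≠ Z i₀) (hK : K ≠ 0) :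
    expCoeff (fun l => ∑ i ∈ univ.erase i₀, σ i *
        ((K * ((Z i - z) / (Z i - Z i₀)) - K * ((Z j - z) / (Z j - Z i₀)))⁻¹) ^ (l + 1)) e = 0
      ↔ expCoeff (powSum σ Z (Z j)) e = 0 := by
  have hD : K * (z - Z i₀) ≠ 0 := mul_ne_zero hK (sub_ne_zero.2 hz)
  have hj0 : Z j - Z i₀ ≠ 0 := sub_ne_zero.2 (hZ.ne hj)
  set A := (Z j - Z i₀) ^ 2 / (K * (z - Z i₀)) with hA
  set k := (Z j - Z i₀) / (K * (z - Z i₀)) with hk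
  have hA0 : A ≠ 0 := div_ne_zero (pow_ne_zero 2 hj0) hD
  have hR : powSum σ Z (Z j) = fun l => ∑ i ∈ univ.erase j, σ i * ((Z i - Z j)⁻¹) ^ (l + 1) := by
    funext l
    rw [powSum, Finset.sum_erase]
    simp
  have hL : (fun l => ∑ i ∈ univ.erase i₀, σ i *
        ((K * ((Z i - z) / (Z i - Z i₀)) - K * ((Z j - z) / (Z j - Z i₀)))⁻¹) ^ (l + 1))
      = fun l => ∑ i ∈ univ.erase j, σ i * (A * (Z i - Z j)⁻¹ + k) ^ (l + 1) := by
    funext l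
    rw [← Finset.sum_erase (a := j) (univ.erase i₀) (by simp), Finset.erase_right_comm,
      ← Finset.sum_erase (a := i₀) (univ.erase j)]
    · refine Finset.sum_congr rfl fun i hi => ?_
      simp only [Finset.mem_erase] at hi
      have h1 : Z i - Z i₀ ≠ 0 := sub_ne_zero.2 (hZ.ne hi.1)
      have h2 : Z i - Z j ≠ 0 := sub_ne_zero.2 (hZ.ne hi.2.1)
      have h3 : K * ((Z i - z) / (Z i - Z i₀)) - K * ((Z j - z) / (Z j - Z i₀))
          = K * (z - Z i₀) * (Z i - Z j) / ((Z i - Z i₀) * (Z j - Z i₀)) := by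
        field_simp
        ring
      rw [h3, hA, hk, inv_div]
      congr 2
      field_simp
      ring
    · have h1 : Z i₀ - Z j ≠ 0 := sub_ne_zero.2 (hZ.ne hj.symm)
      have : A * (Z i₀ - Z j)⁻¹ + k = 0 := by
        rw [hA, hk]
        field_simp
        ring
      simp [this]
  have hsum : ∑ i ∈ univ.erase j, σ i + (e - 1 : ℕ) = 0 := by
    rw [Finset.sum_erase_eq_sub (Finset.mem_univ j), hσ, hσj, Nat.cast_sub he]
    push_cast
    ring
  rw [hL, expCoeff_translate _ σ (fun i => A * (Z i - Z j)⁻¹) he hsum k, hR]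
  have : (fun l => ∑ i ∈ univ.erase j, σ i * (A * (Z i - Z j)⁻¹) ^ (l + 1))
      = fun l => A ^ (l + 1) * ∑ i ∈ univ.erase j, σ i * ((Z i - Z j)⁻¹) ^ (l + 1) := by
    funext l
    rw [Finset.mul_sum]
    refine Finset.sum_congr rfl fun i _ => ?_
    rw [mul_pow, mul_left_comm]
  rw [this, expCoeff_homogeneous, mul_eq_zero, or_iff_right (pow_ne_zero _ hA0)]

end Moebius

section NormalForm

variable {a b c n : ℕ} {d : Fin n → ℕ} {Z W : Fin (3 + n) → ℂ}

/-- The factor normalising the cross-ratio to be `1` at the third point. -/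
noncomputable def crossFactor (Z : Fin (3 + n) → ℂ) : ℂ :=
  (Z (Fin.castAdd n 2) - Z (Fin.castAdd n 0)) / (Z (Fin.castAdd n 2) - Z (Fin.castAdd n 1))

/-- The cross-ratio sending the first three points to `∞`, `0`, `1`. -/
noncomputable def cross (Z : Fin (3 + n) → ℂ) (i : Fin (3 + n)) : ℂ :=
  crossFactor Z * ((Z i - Z (Fin.castAdd n 1)) / (Z i - Z (Fin.castAdd n 0)))

lemma castAdd_ne {i j : Fin 3} (h : i ≠ j) : Fin.castAdd n i ≠ Fin.castAdd n j :=
  fun h' => h (Fin.castAdd_injective 3 n h')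

lemma natAdd_ne_castAdd (i : Fin n) (j : Fin 3) : Fin.natAdd 3 i ≠ Fin.castAdd n j := fun h => by
  have := congrArg Fin.val h
  simp at this
  omega

lemma crossFactor_ne_zero (hZ : Function.Injective Z) : crossFactor Z ≠ 0 :=
  div_ne_zero (sub_ne_zero.2 (hZ.ne (castAdd_ne (by decide))))
    (sub_ne_zero.2 (hZ.ne (castAdd_ne (by decide))))

lemma cross_one : cross Z (Fin.castAdd n 1) = 0 := by simp [cross]

lemma cross_two (hZ : Function.Injective Z) : cross Z (Fin.castAdd n 2) = 1 := by
  have h1 := sub_ne_zero.2 (hZ.ne (castAdd_ne (n := n) (i := 2) (j := 0) (by decide)))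
  have h2 := sub_ne_zero.2 (hZ.ne (castAdd_ne (n := n) (i := 2) (j := 1) (by decide)))
  rw [cross, crossFactor]
  field_simp

lemma eq_of_cross_eq (hZ : Function.Injective Z) {i j : Fin (3 + n)} (hi : i ≠ Fin.castAdd n 0)
    (hj : j ≠ Fin.castAdd n 0) (h : cross Z i = cross Z j) : i = j := by
  have h1 := sub_ne_zero.2 (hZ.ne hi)
  have h2 := sub_ne_zero.2 (hZ.ne hj)
  have h3 := sub_ne_zero.2 (hZ.ne (castAdd_ne (n := n) (i := 1) (j := 0) (by decide)))
  have h := mul_left_cancel₀ (crossFactor_ne_zero hZ) h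
  rw [div_eq_div_iff h1 h2] at h
  refine hZ (mul_left_cancel₀ h3 ?_)
  linear_combination h

lemma sum_mult (hsum : (a : ℤ) - b - c - ∑ i, (d i : ℤ) = -2) :
    ∑ i, -(mult a b c d i : ℂ) = 2 := by
  have h : (a : ℂ) - b - c - ∑ i, (d i : ℂ) = -2 := by exact_mod_cast congrArg (Int.cast (R := ℂ)) hsum
  rw [Fin.sum_univ_add, Fin.sum_univ_three]
  simp only [mult, Fin.append_left, Fin.append_right]
  simp
  linear_combination -h

lemma cross_mem_Sol_iff (hb : 1 ≤ b) (hc : 1 ≤ c) (hd : ∀ i, 2 ≤ d i)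
    (hsum : (a : ℤ) - b - c - ∑ i, (d i : ℤ) = -2) (hZ : Function.Injective Z) :
    (fun i => cross Z (Fin.natAdd 3 i)) ∈ Sol (b + c - 2) d (c : ℂ)
      ↔ ∀ j, residueAt (Z (Fin.natAdd 3 j)) (omegaZ (mult a b c d) Z) = 0 := by
  have hinj : Function.Injective (pts fun i => cross Z (Fin.natAdd 3 i)) := by
    refine injective_pts.2 ⟨fun i j h => ?_, fun i h => ?_, fun i h => ?_⟩
    · exact Fin.natAdd_injective n 3
        (eq_of_cross_eq hZ (natAdd_ne_castAdd _ _) (natAdd_ne_castAdd _ _) h)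
    · exact natAdd_ne_castAdd i 1
        (eq_of_cross_eq hZ (natAdd_ne_castAdd _ _) (castAdd_ne (by decide)) (h.trans cross_one.symm))
    · exact natAdd_ne_castAdd i 2 (eq_of_cross_eq hZ (natAdd_ne_castAdd _ _)
        (castAdd_ne (by decide)) (h.trans (cross_two hZ).symm))
  rw [Sol, Set.mem_ofPred_eq, and_iff_right hinj]
  refine forall_congr' fun j => ?_
  have hj := hd j
  rw [residueAt_omegaZ_eq_zero_iff hZ (e := d j) (by omega) (by simp [mult]),
    ← expCoeff_moebius hZ (sum_mult hsum) (by omega) (natAdd_ne_castAdd j 0) (by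
      rw [Nat.sub_add_cancel (by omega)]
      simp [mult]) (hZ.ne (castAdd_ne (i := 1) (j := 0) (by decide))) (crossFactor_ne_zero hZ)]
  have : powSum (wts (b + c - 2) d c) (pts fun i => cross Z (Fin.natAdd 3 i))
      (cross Z (Fin.natAdd 3 j)) = fun l => ∑ i ∈ univ.erase (Fin.castAdd n 0),
      -(mult a b c d i : ℂ) * ((cross Z i - cross Z (Fin.natAdd 3 j))⁻¹) ^ (l + 1) := by
    funext l
    rw [Finset.sum_erase_eq_sub (Finset.mem_univ _), Fin.sum_univ_add, Fin.sum_univ_three,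
      cross_one, cross_two hZ]
    have hbc : ((b + c - 2 : ℕ) : ℂ) + 2 - c = b := by
      rw [Nat.cast_sub (by omega)]
      push_cast
      ring
    simp only [powSum, wts, pts, Fintype.sum_option, Option.elim'_none, Option.elim'_some, hbc]
    simp only [mult, Fin.append_left, Fin.append_right]
    simp
    ring
  rw [this]
  rfl

lemma exists_cross_eq {t : Fin n → ℂ} (ht : Function.Injective (pts t)) :
    ∃ Z : Fin (3 + n) → ℂ, Function.Injective Z ∧ ∀ i, cross Z (Fin.natAdd 3 i) = t i := by
  obtain ⟨hi, h0, h1⟩ := injective_pts.1 ht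
  obtain ⟨s, hs⟩ := Infinite.exists_notMem_finset (univ.image (pts t))
  have hs : ∀ i, pts t i - s ≠ 0 := fun i h => hs
    (Finset.mem_image.2 ⟨i, Finset.mem_univ i, sub_eq_zero.1 h⟩)
  have hs0 : s ≠ 0 := by simpa [pts] using hs none
  have hs1 : 1 - s ≠ 0 := hs (some none)
  have hst : ∀ i, t i - s ≠ 0 := fun i => hs (some (some i))
  have hs01 : (1 - s)⁻¹ + s⁻¹ ≠ 0 := by
    rw [inv_add_inv hs1 hs0, sub_add_cancel]
    exact div_ne_zero one_ne_zero (mul_ne_zero hs1 hs0)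
  refine ⟨Fin.append ![0, (0 - s)⁻¹, (1 - s)⁻¹] fun i => (t i - s)⁻¹,
    Fin.append_injective_iff.2 ⟨?_, fun i j h => ?_, fun i j => ?_⟩, fun i => ?_⟩
  · intro i j h
    fin_cases i <;> fin_cases j <;> simp [hs0, hs1, neg_eq_iff_eq_neg] at h ⊢
    · exact hs1 h.symm
    · exact hs01 (by linear_combination h)
    · exact hs01 (by linear_combination h)
  · exact hi (sub_left_injective (inv_injective h))
  · fin_cases i
    · simpa using (hst j).symm
    · simpa [-zero_sub, -neg_inj] using fun h => h0 j h.symm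
    · simpa using fun h => h1 j h.symm
  · have := hst i
    simp only [cross, crossFactor, Fin.append_left, Fin.append_right]
    simp
    field_simp
    ring

lemma cross_eq_of_moebius (hZ : Function.Injective Z) {p q r s : ℂ} (hdet : p * s - q * r ≠ 0)
    (h : ∀ i, r * Z i + s ≠ 0 ∧ W i = (p * Z i + q) / (r * Z i + s)) (i : Fin (3 + n))
    (hi : i ≠ Fin.castAdd n 0) : cross W i = cross Z i := by
  have hsub : ∀ i j, W i - W j
      = (p * s - q * r) * (Z i - Z j) / ((r * Z i + s) * (r * Z j + s)) := fun i j => by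
    have h1 := (h i).1
    have h2 := (h j).1
    rw [(h i).2, (h j).2, div_sub_div _ _ h1 h2]
    congr 1
    ring
  have h1 := sub_ne_zero.2 (hZ.ne hi)
  have h2 := sub_ne_zero.2 (hZ.ne (castAdd_ne (n := n) (i := 2) (j := 1) (by decide)))
  have n0 := (h (Fin.castAdd n 0)).1
  have n1 := (h (Fin.castAdd n 1)).1
  have n2 := (h (Fin.castAdd n 2)).1
  have n3 := (h i).1
  rw [cross, cross, crossFactor, crossFactor, hsub, hsub, hsub, hsub]
  field_simp

lemma exists_moebius (hZ : Function.Injective Z) (hW : Function.Injective W)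
    (h : ∀ i, i ≠ Fin.castAdd n 0 → cross Z i = cross W i) :
    ∃ p q r s : ℂ, p * s - q * r ≠ 0 ∧
      ∀ i, r * Z i + s ≠ 0 ∧ W i = (p * Z i + q) / (r * Z i + s) := by
  have hz := sub_ne_zero.2 (hZ.ne (castAdd_ne (n := n) (i := 0) (j := 1) (by decide)))
  have hw := sub_ne_zero.2 (hW.ne (castAdd_ne (n := n) (i := 0) (j := 1) (by decide)))
  have hK := crossFactor_ne_zero hZ
  have hK' := crossFactor_ne_zero hW
  simp only [cross] at h
  set K := crossFactor Z
  set K' := crossFactor W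
  set z₁ := Z (Fin.castAdd n 0) with hz₁
  set z₂ := Z (Fin.castAdd n 1)
  set w₁ := W (Fin.castAdd n 0) with hw₁
  set w₂ := W (Fin.castAdd n 1)
  refine ⟨K * w₁ - K' * w₂, K' * w₂ * z₁ - K * z₂ * w₁, K - K', K' * z₁ - K * z₂, ?_, fun i => ?_⟩
  · have : (K * w₁ - K' * w₂) * (K' * z₁ - K * z₂) - (K' * w₂ * z₁ - K * z₂ * w₁) * (K - K')
        = K * K' * (w₁ - w₂) * (z₁ - z₂) := by ring
    rw [this]
    exact mul_ne_zero (mul_ne_zero (mul_ne_zero hK hK') hw) hz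
  · by_cases hi : i = Fin.castAdd n 0
    · have hden : (K - K') * z₁ + (K' * z₁ - K * z₂) ≠ 0 := by
        have : (K - K') * z₁ + (K' * z₁ - K * z₂) = K * (z₁ - z₂) := by ring
        rw [this]
        exact mul_ne_zero hK hz
      rw [hi, ← hz₁, ← hw₁]
      exact ⟨hden, by rw [eq_div_iff hden]; ring⟩
    · have hzi : Z i - z₁ ≠ 0 := sub_ne_zero.2 (hZ.ne hi)
      have hwi : W i - w₁ ≠ 0 := sub_ne_zero.2 (hW.ne hi)
      have h := h i hi
      rw [← mul_div_assoc, ← mul_div_assoc, div_eq_div_iff hzi hwi] at h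
      have hden : (K - K') * Z i + (K' * z₁ - K * z₂) ≠ 0 := fun h0 => by
        have : (Z i - z₁) * (K' * (w₁ - w₂)) = 0 := by
          linear_combination (W i - w₁) * h0 - h
        exact mul_ne_zero hzi (mul_ne_zero hK' hw) this
      exact ⟨hden, by rw [eq_div_iff hden]; linear_combination h⟩

lemma card_quot_moebiusRel (hb : 1 ≤ b) (hc : 1 ≤ c) (hd : ∀ i, 2 ≤ d i)
    (hsum : (a : ℤ) - b - c - ∑ i, (d i : ℤ) = -2) :
    Nat.card (Quot (moebiusRel a b c d)) = (Sol (b + c - 2) d (c : ℂ)).ncard := by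
  rw [← Nat.card_coe_set_eq]
  have hcross : ∀ Z W : H₀second a b c d, moebiusRel a b c d Z W →
      (fun i => cross Z.1 (Fin.natAdd 3 i)) = fun i => cross W.1 (Fin.natAdd 3 i) := by
    rintro Z W ⟨p, q, r, s, hdet, h⟩
    funext i
    exact (cross_eq_of_moebius Z.2.1 hdet h _ (natAdd_ne_castAdd i 0)).symm
  let F : Quot (moebiusRel a b c d) → Sol (b + c - 2) d (c : ℂ) := Quot.lift
    (fun Z => ⟨fun i => cross Z.1 (Fin.natAdd 3 i),
      (cross_mem_Sol_iff hb hc hd hsum Z.2.1).2 Z.2.2⟩)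
    fun Z W h => Subtype.ext (hcross Z W h)
  refine Nat.card_congr (Equiv.ofBijective F ⟨?_, fun t => ?_⟩)
  · rintro ⟨Z⟩ ⟨W⟩ h
    have h : (fun i => cross Z.1 (Fin.natAdd 3 i)) = fun i => cross W.1 (Fin.natAdd 3 i) :=
      congrArg Subtype.val h
    refine Quot.sound (exists_moebius Z.2.1 W.2.1 fun i => ?_)
    induction i using Fin.addCases with
    | left i =>
      fin_cases i
      · exact fun h => absurd rfl h
      · exact fun _ => cross_one.trans cross_one.symm
      · exact fun _ => (cross_two Z.2.1).trans (cross_two W.2.1).symm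
    | right i => exact fun _ => congrFun h i
  · obtain ⟨Z, hZ, hcr⟩ := exists_cross_eq t.2.1
    have hcr : (fun i => cross Z (Fin.natAdd 3 i)) = t.1 := funext hcr
    exact ⟨Quot.mk _ ⟨Z, hZ, (cross_mem_Sol_iff hb hc hd hsum hZ).1 (hcr ▸ t.2)⟩, Subtype.ext hcr⟩

end NormalForm

end SecondKind

/-- count of differentials of the second type: for `a ≥ 0`, `b, c ≥ 1`,
`dᵢ ≥ 2` with `a - b - c - ∑ dᵢ = -2`, the number of meromorphic differentials on `ℂP¹`
(up to `PGL(2,ℂ)`) with divisor `a[z₁] - b[z₂] - c[z₃] - ∑ dᵢ[z_{3+i}]` and vanishing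
residues at `z₄, …, z_{3+n}` equals `n! ∏ (dᵢ - 1)`. -/
theorem statement14 (a b c : ℕ) (hb : 1 ≤ b) (hc : 1 ≤ c) (n : ℕ) (d : Fin n → ℕ)
    (hd : ∀ i, 2 ≤ d i) (hsum : (a : ℤ) - b - c - ∑ i, (d i : ℤ) = -2) :
    Nat.card (Quot (moebiusRel a b c d)) = n.factorial * ∏ i, (d i - 1) := by
  rw [SecondKind.card_quot_moebiusRel hb hc hd hsum, ← Complex.ofReal_natCast c]
  refine SecondKind.ncard_Sol n (Fintype.card_fin n) hd (Nat.cast_pos.2 hc) ?_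
  rw [Nat.cast_sub (by omega)]
  push_cast
  linarith [(Nat.one_le_cast (α := ℝ)).2 hb]
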